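/- Let A be a compact homologically smooth DG algebra. A DG A-module N is perfect (N ∈ D_per(A)) if and only if its total cohomology H(N) = ⊕_n H^n(N) is finite-dimensional over k. -/

import Mathlib

/- Framework: differential graded algebras (internal ℤ-grading), right DG modules,
DG bimodules, homotopy-theoretic notions (twisted modules, perfectness,
homological smoothness), cohomology and Hochschild homology. -/

open DirectSum TensorProduct

noncomputable section
set_option linter.unusedVariables false

/-- `(-1)^i` for `i : ℤ`, valued in `ℤ`. -/
def sgnz (i : ℤ) : ℤ := if Even i then 1 else -1

/-- `(-1)^i` for `i : ℤ`, valued in a field `k`. -/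
def sgnk (k : Type) [Field k] (i : ℤ) : k := if Even i then 1 else -1

/-- A differential graded algebra over a field `k`: a `k`-algebra with an internal
ℤ-grading and a square-zero degree `+1` differential satisfying the graded Leibniz rule. -/
structure DGAlgebra (k : Type) [Field k] : Type 1 where
  R : Type
  [ring : Ring R]
  [alg : Algebra k R]
  gr : ℤ → Submodule k R
  [dec : DirectSum.Decomposition gr]
  one_mem : (1 : R) ∈ gr 0
  mul_mem : ∀ {i j : ℤ} {x y : R}, x ∈ gr i → y ∈ gr j → x * y ∈ gr (i + j)
  d : R →ₗ[k] R
  d_deg : ∀ (i : ℤ), ∀ x ∈ gr i, d x ∈ gr (i + 1)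
  d_sq : ∀ x : R, d (d x) = 0
  leibniz : ∀ (i : ℤ), ∀ x ∈ gr i, ∀ y : R,
    d (x * y) = d x * y + sgnz i • (x * d y)

attribute [instance] DGAlgebra.ring DGAlgebra.alg DGAlgebra.dec

variable {k : Type} [Field k]

/-- A right DG module over a DG algebra `A`.  The right action of `x : A` on `m`
is written `act x m` (representing `m · x`). -/
structure DGMod (A : DGAlgebra k) : Type 1 where
  M : Type
  [acg : AddCommGroup M]
  [kmod : Module k M]
  gm : ℤ → Submodule k M
  [dec : DirectSum.Decomposition gm]
  act : A.R →ₗ[k] M →ₗ[k] M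
  act_one : ∀ m : M, act 1 m = m
  act_mul : ∀ (x y : A.R) (m : M), act (x * y) m = act y (act x m)
  act_deg : ∀ (i j : ℤ) (x : A.R) (m : M), x ∈ A.gr i → m ∈ gm j → act x m ∈ gm (j + i)
  D : M →ₗ[k] M
  D_deg : ∀ (j : ℤ), ∀ m ∈ gm j, D m ∈ gm (j + 1)
  D_sq : ∀ m : M, D (D m) = 0
  leibniz : ∀ (i j : ℤ) (x : A.R) (m : M), x ∈ A.gr i → m ∈ gm j →
    D (act x m) = act x (D m) + sgnz j • act (A.d x) m

attribute [instance] DGMod.acg DGMod.kmod DGMod.dec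

variable {A : DGAlgebra k}

/-- Morphisms of right DG modules (closed, degree 0). -/
structure DGHom (X Y : DGMod A) where
  f : X.M →ₗ[k] Y.M
  deg : ∀ (j : ℤ), ∀ m ∈ X.gm j, f m ∈ Y.gm j
  actc : ∀ (x : A.R) (m : X.M), f (X.act x m) = Y.act x (f m)
  comm : ∀ m : X.M, f (X.D m) = Y.D (f m)

/-- The identity morphism. -/
def DGHom.id (X : DGMod A) : DGHom X X :=
  ⟨LinearMap.id, fun _ _ h => h, fun _ _ => rfl, fun _ => rfl⟩

/-- Composition of morphisms of DG modules. -/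
def DGHom.comp {X Y Z : DGMod A} (G : DGHom Y Z) (F : DGHom X Y) : DGHom X Z :=
  ⟨G.f ∘ₗ F.f, fun j m h => G.deg j _ (F.deg j m h),
    fun x m => by simp [LinearMap.comp_apply, F.actc, G.actc],
    fun m => by simp [LinearMap.comp_apply, F.comm, G.comm]⟩

/-- The zero morphism. -/
def DGHom.zero (X Y : DGMod A) : DGHom X Y :=
  ⟨0, fun j _ _ => (Y.gm j).zero_mem, fun _ _ => by simp, fun _ => by simp⟩

/-- Chain homotopy between two morphisms of DG modules. -/
def Homotopic {X Y : DGMod A} (F G : DGHom X Y) : Prop :=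
  ∃ h : X.M →ₗ[k] Y.M,
    (∀ (j : ℤ), ∀ m ∈ X.gm j, h m ∈ Y.gm (j - 1)) ∧
    (∀ (x : A.R) (m : X.M), h (X.act x m) = Y.act x (h m)) ∧
    ∀ m : X.M, F.f m - G.f m = Y.D (h m) + h (X.D m)

/-- Cycles of degree `n` of a complex given by a grading and a differential. -/
def Zg {M : Type} [AddCommGroup M] [Module k M]
    (gm : ℤ → Submodule k M) (Dm : M →ₗ[k] M) (n : ℤ) : Submodule k M :=
  gm n ⊓ LinearMap.ker Dm

/-- Boundaries of degree `n`. -/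
def Bg {M : Type} [AddCommGroup M] [Module k M]
    (gm : ℤ → Submodule k M) (Dm : M →ₗ[k] M) (n : ℤ) : Submodule k M :=
  gm n ⊓ LinearMap.range Dm

/-- Degree `n` cohomology of a complex. -/
def Hg {M : Type} [AddCommGroup M] [Module k M]
    (gm : ℤ → Submodule k M) (Dm : M →ₗ[k] M) (n : ℤ) : Type :=
  ↥(Zg gm Dm n) ⧸ (Submodule.comap (Zg gm Dm n).subtype (Bg gm Dm n))

instance {M : Type} [AddCommGroup M] [Module k M]
    (gm : ℤ → Submodule k M) (Dm : M →ₗ[k] M) (n : ℤ) : AddCommGroup (Hg gm Dm n) := by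
  unfold Hg; infer_instance

instance {M : Type} [AddCommGroup M] [Module k M]
    (gm : ℤ → Submodule k M) (Dm : M →ₗ[k] M) (n : ℤ) : Module k (Hg gm Dm n) := by
  unfold Hg; infer_instance

/-- `f` induces an isomorphism on the homology of two complexes presented by
(families of) cycle and boundary submodules. -/
def InducesHIso {M₁ M₂ : Type} [AddCommGroup M₁] [Module k M₁] [AddCommGroup M₂] [Module k M₂]
    (Z₁ B₁ : ℤ → Submodule k M₁) (Z₂ B₂ : ℤ → Submodule k M₂) (f : M₁ →ₗ[k] M₂) : Prop :=
  (∀ n : ℤ, ∀ x ∈ Z₁ n, f x ∈ Z₂ n) ∧ (∀ n : ℤ, ∀ x ∈ B₁ n, f x ∈ B₂ n) ∧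
  ∀ n : ℤ, (∀ z ∈ Z₂ n, ∃ w ∈ Z₁ n, f w - z ∈ B₂ n) ∧
    (∀ w ∈ Z₁ n, f w ∈ B₂ n → w ∈ B₁ n)

/-- Quasi-isomorphism of complexes, in elementary terms. -/
def QIsoData {M₁ M₂ : Type} [AddCommGroup M₁] [Module k M₁] [AddCommGroup M₂] [Module k M₂]
    (gm₁ : ℤ → Submodule k M₁) (D₁ : M₁ →ₗ[k] M₁)
    (gm₂ : ℤ → Submodule k M₂) (D₂ : M₂ →ₗ[k] M₂) (f : M₁ →ₗ[k] M₂) : Prop :=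
  InducesHIso (Zg gm₁ D₁) (Bg gm₁ D₁) (Zg gm₂ D₂) (Bg gm₂ D₂) f

/-- A morphism of DG modules is a quasi-isomorphism if it induces isomorphisms on
all cohomology groups. -/
def IsQuasiIso {X Y : DGMod A} (F : DGHom X Y) : Prop :=
  QIsoData X.gm X.D Y.gm Y.D F.f

/-- A DG module is acyclic if all its cohomology vanishes. -/
def AcyclicM (X : DGMod A) : Prop := ∀ n : ℤ, Zg X.gm X.D n ≤ Bg X.gm X.D n

/-- The `A`-submodule of a right DG module generated by a set. -/
def rSpan (X : DGMod A) (S : Set X.M) : Submodule k X.M :=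
  sInf {p : Submodule k X.M | S ⊆ ↑p ∧ ∀ (x : A.R) (m : X.M), m ∈ p → X.act x m ∈ p}

/-- Twisted modules: finitely generated semi-free right DG `A`-modules, i.e.
modules with a finite homogeneous basis `e` such that `D (e j)` lies in the
`A`-span of the previous basis elements ("strictly upper triangular" twisting). -/
def IsTwisted (T : DGMod A) : Prop :=
  ∃ (s : ℕ) (r : Fin s → ℤ) (e : Fin s → T.M),
    (∀ j, e j ∈ T.gm (-(r j))) ∧
    (∀ j, T.D (e j) ∈ rSpan T (e '' {i | i < j})) ∧
    Function.Bijective (fun v : Fin s → A.R => ∑ j, T.act (v j) (e j))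

/-- `P` is a homotopy direct summand of `T`. -/
def IsHoSummand (P T : DGMod A) : Prop :=
  ∃ (ι : DGHom P T) (ρ : DGHom T P), Homotopic (ρ.comp ι) (DGHom.id P)

/-- A perfect DG module: one admitting a resolution by a homotopy direct summand
of a twisted module. -/
def IsPerfect (N : DGMod A) : Prop :=
  ∃ T P : DGMod A, IsTwisted T ∧ IsHoSummand P T ∧ ∃ F : DGHom P N, IsQuasiIso F

/-- Homotopically projective (K-projective) DG modules. -/
def IsHoProjM (P : DGMod A) : Prop :=
  ∀ N : DGMod A, AcyclicM N → ∀ F : DGHom P N, Homotopic F (DGHom.zero P N)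

/-- Compactness of a DG algebra: the total cohomology is finite dimensional. -/
def IsCompactAlg (A : DGAlgebra k) : Prop :=
  (∀ n : ℤ, FiniteDimensional k (Hg A.gr A.d n)) ∧
    {n : ℤ | ¬ Subsingleton (Hg A.gr A.d n)}.Finite
/-- The grading operator on a graded module scaling the degree `j` component by `c j`. -/
def gop {M : Type} [AddCommGroup M] [Module k M]
    (gm : ℤ → Submodule k M) [DirectSum.Decomposition gm] (c : ℤ → k) : M →ₗ[k] M :=
  (DirectSum.toModule k ℤ M (fun j => c j • (gm j).subtype)) ∘ₗ
    (DirectSum.decomposeLinearEquiv gm).toLinearMap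

/-- A DG bimodule over `A` (equivalently, a right DG module over `Aᵉ = Aᵒᵖ ⊗ A`). -/
structure DGBimod (A : DGAlgebra k) : Type 1 where
  M : Type
  [acg : AddCommGroup M]
  [kmod : Module k M]
  gm : ℤ → Submodule k M
  [dec : DirectSum.Decomposition gm]
  actL : A.R →ₗ[k] M →ₗ[k] M
  actR : A.R →ₗ[k] M →ₗ[k] M
  actL_one : ∀ m : M, actL 1 m = m
  actR_one : ∀ m : M, actR 1 m = m
  actL_mul : ∀ (x y : A.R) (m : M), actL (x * y) m = actL x (actL y m)
  actR_mul : ∀ (x y : A.R) (m : M), actR (x * y) m = actR y (actR x m)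
  actLR : ∀ (x y : A.R) (m : M), actL x (actR y m) = actR y (actL x m)
  actL_deg : ∀ (i j : ℤ) (x : A.R) (m : M), x ∈ A.gr i → m ∈ gm j → actL x m ∈ gm (i + j)
  actR_deg : ∀ (i j : ℤ) (x : A.R) (m : M), x ∈ A.gr i → m ∈ gm j → actR x m ∈ gm (j + i)
  D : M →ₗ[k] M
  D_deg : ∀ (j : ℤ), ∀ m ∈ gm j, D m ∈ gm (j + 1)
  D_sq : ∀ m : M, D (D m) = 0
  leibnizL : ∀ (i j : ℤ) (x : A.R) (m : M), x ∈ A.gr i → m ∈ gm j →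
    D (actL x m) = actL (A.d x) m + sgnz i • actL x (D m)
  leibnizR : ∀ (i j : ℤ) (x : A.R) (m : M), x ∈ A.gr i → m ∈ gm j →
    D (actR x m) = actR x (D m) + sgnz j • actR (A.d x) m

attribute [instance] DGBimod.acg DGBimod.kmod DGBimod.dec

/-- Morphisms of DG bimodules (closed, degree 0). -/
structure BimodHom {A : DGAlgebra k} (X Y : DGBimod A) where
  f : X.M →ₗ[k] Y.M
  deg : ∀ (j : ℤ), ∀ m ∈ X.gm j, f m ∈ Y.gm j
  actLc : ∀ (x : A.R) (m : X.M), f (X.actL x m) = Y.actL x (f m)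
  actRc : ∀ (x : A.R) (m : X.M), f (X.actR x m) = Y.actR x (f m)
  comm : ∀ m : X.M, f (X.D m) = Y.D (f m)

def BimodHom.id (X : DGBimod A) : BimodHom X X :=
  ⟨LinearMap.id, fun _ _ h => h, fun _ _ => rfl, fun _ _ => rfl, fun _ => rfl⟩

def BimodHom.comp {X Y Z : DGBimod A} (G : BimodHom Y Z) (F : BimodHom X Y) : BimodHom X Z :=
  ⟨G.f ∘ₗ F.f, fun j m h => G.deg j _ (F.deg j m h),
    fun x m => by simp [LinearMap.comp_apply, F.actLc, G.actLc],
    fun x m => by simp [LinearMap.comp_apply, F.actRc, G.actRc],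
    fun m => by simp [LinearMap.comp_apply, F.comm, G.comm]⟩

def BimodHom.zero (X Y : DGBimod A) : BimodHom X Y :=
  ⟨0, fun j _ _ => (Y.gm j).zero_mem, fun _ _ => by simp, fun _ _ => by simp, fun _ => by simp⟩

/-- Chain homotopy between morphisms of DG bimodules (with the Koszul sign for the
left action). -/
def BimodHomotopic {X Y : DGBimod A} (F G : BimodHom X Y) : Prop :=
  ∃ h : X.M →ₗ[k] Y.M,
    (∀ (j : ℤ), ∀ m ∈ X.gm j, h m ∈ Y.gm (j - 1)) ∧
    (∀ (i : ℤ) (x : A.R), x ∈ A.gr i → ∀ m : X.M, h (X.actL x m) = sgnz i • Y.actL x (h m)) ∧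
    (∀ (x : A.R) (m : X.M), h (X.actR x m) = Y.actR x (h m)) ∧
    ∀ m : X.M, F.f m - G.f m = Y.D (h m) + h (X.D m)

def AcyclicB (X : DGBimod A) : Prop := ∀ n : ℤ, Zg X.gm X.D n ≤ Bg X.gm X.D n

def IsHoProjB (P : DGBimod A) : Prop :=
  ∀ N : DGBimod A, AcyclicB N → ∀ F : BimodHom P N, BimodHomotopic F (BimodHom.zero P N)

/-- Auxiliary: the action of a homogeneous element of degree `i` in the first tensor
factor of `Aᵉ` on a bimodule, with its Koszul sign. -/
def biactAux (N : DGBimod A) (i : ℤ) : ↥(A.gr i) →ₗ[k] A.R →ₗ[k] N.M →ₗ[k] N.M where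
  toFun x :=
    { toFun := fun y => (N.actL ↑x) ∘ₗ (N.actR y) ∘ₗ (gop N.gm fun j => sgnk k (i * j))
      map_add' := by intro y z; ext m; simp
      map_smul' := by intro c y; ext m; simp }
  map_add' := by intro x z; ext y m; simp [Submodule.coe_add]
  map_smul' := by intro c x; ext y m; simp

/-- The right action of `Aᵉ = Aᵒᵖ ⊗ A` (as a `k`-module, `A.R ⊗[k] A.R`) on a DG
bimodule, with Koszul signs. -/
def biact (N : DGBimod A) : (A.R ⊗[k] A.R) →ₗ[k] N.M →ₗ[k] N.M :=
  TensorProduct.lift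
    ((DirectSum.toModule k ℤ _ (fun i => biactAux N i)) ∘ₗ
      (DirectSum.decomposeLinearEquiv A.gr).toLinearMap)

/-- The sub-bimodule generated by a set. -/
def biSpan (N : DGBimod A) (S : Set N.M) : Submodule k N.M :=
  sInf {p : Submodule k N.M | S ⊆ ↑p ∧ (∀ (x : A.R) (m : N.M), m ∈ p → N.actL x m ∈ p) ∧
    ∀ (x : A.R) (m : N.M), m ∈ p → N.actR x m ∈ p}

/-- Twisted DG bimodules: finitely generated semi-free DG `Aᵉ`-modules. -/
def IsTwistedB (T : DGBimod A) : Prop :=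
  ∃ (s : ℕ) (r : Fin s → ℤ) (e : Fin s → T.M),
    (∀ j, e j ∈ T.gm (-(r j))) ∧
    (∀ j, T.D (e j) ∈ biSpan T (e '' {i | i < j})) ∧
    Function.Bijective (fun v : Fin s → A.R ⊗[k] A.R => ∑ j, biact T (v j) (e j))

def IsHoSummandB (P T : DGBimod A) : Prop :=
  ∃ (ι : BimodHom P T) (ρ : BimodHom T P), BimodHomotopic (ρ.comp ι) (BimodHom.id P)

def IsPerfectB (N : DGBimod A) : Prop :=
  ∃ T P : DGBimod A, IsTwistedB T ∧ IsHoSummandB P T ∧ ∃ F : BimodHom P N, QIsoData P.gm P.D N.gm N.D F.f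

/-- The diagonal bimodule: `A` as a DG bimodule over itself. -/
def diagBimod (A : DGAlgebra k) : DGBimod A where
  M := A.R
  gm := A.gr
  actL := LinearMap.mul k A.R
  actR := (LinearMap.mul k A.R).flip
  actL_one := fun m => one_mul m
  actR_one := fun m => mul_one m
  actL_mul := fun x y m => mul_assoc x y m
  actR_mul := fun x y m => (mul_assoc m x y).symm
  actLR := fun x y m => (mul_assoc x m y).symm
  actL_deg := fun i j x m hx hm => A.mul_mem hx hm
  actR_deg := fun i j x m hx hm => A.mul_mem hm hx
  D := A.d
  D_deg := A.d_deg
  D_sq := A.d_sq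
  leibnizL := fun i j x m hx _ => A.leibniz i x hx m
  leibnizR := fun i j x m _ hm => A.leibniz j m hm x

/-- `A` is homologically smooth if the diagonal bimodule is perfect over `Aᵉ`. -/
def IsSmooth (A : DGAlgebra k) : Prop := IsPerfectB (diagBimod A)

/-- The graded commutator subspace `[A, P] ⊆ P` of a DG bimodule. -/
def commSub (P : DGBimod A) : Submodule k P.M :=
  Submodule.span k {z : P.M | ∃ (i j : ℤ) (x : A.R) (m : P.M), x ∈ A.gr i ∧ m ∈ P.gm j ∧
    z = P.actL x m - sgnz (i * j) • P.actR x m}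

/-- Degree-`n` cycles of the complex `P/[A,P]` (computing `P ⊗_{Aᵉ} A`), described by
representatives in `P`. -/
def HHZ (P : DGBimod A) (n : ℤ) : Submodule k P.M :=
  P.gm n ⊓ (commSub P).comap P.D

/-- Degree-`n` boundaries of the complex `P/[A,P]`, described by representatives. -/
def HHB (P : DGBimod A) (n : ℤ) : Submodule k P.M :=
  P.gm n ⊓ (commSub P ⊔ LinearMap.range P.D)

/-- The `n`-th Hochschild homology group `HH_n(A) = H^n(P ⊗_{Aᵉ} A)` computed from a
bimodule resolution `P` of the diagonal. -/
def HHspace (P : DGBimod A) (n : ℤ) : Type :=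
  ↥(HHZ P n) ⧸ (Submodule.comap (HHZ P n).subtype (HHB P n ⊓ HHZ P n))

instance (P : DGBimod A) (n : ℤ) : AddCommGroup (HHspace P n) := by
  unfold HHspace; infer_instance

instance (P : DGBimod A) (n : ℤ) : Module k (HHspace P n) := by
  unfold HHspace; infer_instance

/-- `F : P → A` is an h-projective bimodule resolution of the diagonal bimodule. -/
def IsDiagResolution {A : DGAlgebra k} (P : DGBimod A) (F : BimodHom P (diagBimod A)) : Prop :=
  IsHoProjB P ∧ QIsoData P.gm P.D (diagBimod A).gm (diagBimod A).D F.f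
/-! ### Hom complexes and Ext spaces -/

/-- The degree-`n` part of the Hom complex of two right DG `A`-modules:
`A`-linear maps shifting degrees by `n`. -/
def homGrade (X Y : DGMod A) (n : ℤ) : Submodule k (X.M →ₗ[k] Y.M) where
  carrier := {f | (∀ (j : ℤ), ∀ m ∈ X.gm j, f m ∈ Y.gm (j + n)) ∧
    ∀ (x : A.R) (m : X.M), f (X.act x m) = Y.act x (f m)}
  add_mem' := by
    rintro f g ⟨hf1, hf2⟩ ⟨hg1, hg2⟩
    refine ⟨fun j m hm => ?_, fun x m => ?_⟩
    · exact (Y.gm (j + n)).add_mem (hf1 j m hm) (hg1 j m hm)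
    · simp [hf2, hg2]
  zero_mem' := by
    refine ⟨fun j m hm => (Y.gm (j + n)).zero_mem, fun x m => by simp⟩
  smul_mem' := by
    rintro c f ⟨hf1, hf2⟩
    refine ⟨fun j m hm => (Y.gm (j + n)).smul_mem c (hf1 j m hm), fun x m => ?_⟩
    simp [hf2]

theorem mem_homGrade {X Y : DGMod A} {n : ℤ} {f : X.M →ₗ[k] Y.M} :
    f ∈ homGrade X Y n ↔ ((∀ (j : ℤ), ∀ m ∈ X.gm j, f m ∈ Y.gm (j + n)) ∧
      ∀ (x : A.R) (m : X.M), f (X.act x m) = Y.act x (f m)) := Iff.rfl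

/-- The differential of the Hom complex in degree `n`:
`f ↦ D_Y ∘ f - (-1)^n f ∘ D_X`. -/
def homDop (X Y : DGMod A) (n : ℤ) : (X.M →ₗ[k] Y.M) →ₗ[k] (X.M →ₗ[k] Y.M) :=
  (LinearMap.llcomp k X.M Y.M Y.M) Y.D - sgnz n • (LinearMap.llcomp k X.M X.M Y.M).flip X.D

/-- Closed degree-`n` `A`-linear maps. -/
def ZHomS (X Y : DGMod A) (n : ℤ) : Submodule k (X.M →ₗ[k] Y.M) :=
  homGrade X Y n ⊓ LinearMap.ker (homDop X Y n)

/-- Degree-`n` boundaries of the Hom complex. -/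
def BHomS (X Y : DGMod A) (n : ℤ) : Submodule k (X.M →ₗ[k] Y.M) :=
  Submodule.map (homDop X Y (n - 1)) (homGrade X Y (n - 1))

/-- `Hom_{Ho(A)}(X, Y[n])`: the `n`-th cohomology of the Hom complex.  For
homotopically projective `X` this computes `Hom_{D(A)}(X, Y[n])`. -/
def ExtSpace (X Y : DGMod A) (n : ℤ) : Type :=
  ↥(ZHomS X Y n) ⧸ (Submodule.comap (ZHomS X Y n).subtype (BHomS X Y n ⊓ ZHomS X Y n))

instance (X Y : DGMod A) (n : ℤ) : AddCommGroup (ExtSpace X Y n) := by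
  unfold ExtSpace; infer_instance

instance (X Y : DGMod A) (n : ℤ) : Module k (ExtSpace X Y n) := by
  unfold ExtSpace; infer_instance

/-! ### Shifts, cones, isomorphisms in the homotopy category -/

/-- `X'` realizes the shift `X[t]` (so `X'^n = X^{n+t}`). -/
def IsShiftOf (X X' : DGMod A) (t : ℤ) : Prop :=
  ∃ g : X.M ≃ₗ[k] X'.M,
    (∀ n : ℤ, ∀ m ∈ X.gm (n + t), g m ∈ X'.gm n) ∧
    (∀ (x : A.R) (m : X.M), g (X.act x m) = X'.act x (g m)) ∧
    ∀ m : X.M, g (X.D m) = sgnz t • X'.D (g m)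

/-- `C` realizes the cone of the closed morphism `F : X → Y` with canonical
inclusion `j : Y → C`. -/
def IsConeOf {X Y : DGMod A} (F : DGHom X Y) (C : DGMod A) (j : DGHom Y C) : Prop :=
  ∃ (p : C.M →ₗ[k] X.M) (s : X.M →ₗ[k] C.M) (q : C.M →ₗ[k] Y.M),
    (∀ n : ℤ, ∀ c ∈ C.gm n, p c ∈ X.gm (n + 1)) ∧
    (∀ n : ℤ, ∀ m ∈ X.gm (n + 1), s m ∈ C.gm n) ∧
    (∀ n : ℤ, ∀ c ∈ C.gm n, q c ∈ Y.gm n) ∧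
    (∀ (x : A.R) (c : C.M), p (C.act x c) = X.act x (p c)) ∧
    (∀ (x : A.R) (m : X.M), s (X.act x m) = C.act x (s m)) ∧
    (∀ (x : A.R) (c : C.M), q (C.act x c) = Y.act x (q c)) ∧
    (∀ y : Y.M, q (j.f y) = y) ∧ (∀ m : X.M, p (s m) = m) ∧
    (∀ m : X.M, q (s m) = 0) ∧ (∀ y : Y.M, p (j.f y) = 0) ∧
    (∀ c : C.M, j.f (q c) + s (p c) = c) ∧
    ∀ m : X.M, C.D (s m) = j.f (F.f m) - s (X.D m)

/-- Isomorphism in the homotopy category of DG modules. -/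
def HoIso (X Y : DGMod A) : Prop :=
  ∃ (F : DGHom X Y) (G : DGHom Y X),
    Homotopic (G.comp F) (DGHom.id X) ∧ Homotopic (F.comp G) (DGHom.id Y)
/-! ### Left DG modules (right modules over `Aᵒᵖ`) and duality complexes -/

/-- A left DG module over `A` (equivalently, a right DG module over `Aᵒᵖ`). -/
structure DGModL (A : DGAlgebra k) : Type 1 where
  M : Type
  [acg : AddCommGroup M]
  [kmod : Module k M]
  gm : ℤ → Submodule k M
  [dec : DirectSum.Decomposition gm]
  actL : A.R →ₗ[k] M →ₗ[k] M
  actL_one : ∀ m : M, actL 1 m = m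
  actL_mul : ∀ (x y : A.R) (m : M), actL (x * y) m = actL x (actL y m)
  actL_deg : ∀ (i j : ℤ) (x : A.R) (m : M), x ∈ A.gr i → m ∈ gm j → actL x m ∈ gm (i + j)
  D : M →ₗ[k] M
  D_deg : ∀ (j : ℤ), ∀ m ∈ gm j, D m ∈ gm (j + 1)
  D_sq : ∀ m : M, D (D m) = 0
  leibnizL : ∀ (i j : ℤ) (x : A.R) (m : M), x ∈ A.gr i → m ∈ gm j →
    D (actL x m) = actL (A.d x) m + sgnz i • actL x (D m)

attribute [instance] DGModL.acg DGModL.kmod DGModL.dec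

/-- Morphisms of left DG modules. -/
structure DGHomL (X Y : DGModL A) where
  f : X.M →ₗ[k] Y.M
  deg : ∀ (j : ℤ), ∀ m ∈ X.gm j, f m ∈ Y.gm j
  actc : ∀ (x : A.R) (m : X.M), f (X.actL x m) = Y.actL x (f m)
  comm : ∀ m : X.M, f (X.D m) = Y.D (f m)

def DGHomL.id (X : DGModL A) : DGHomL X X :=
  ⟨LinearMap.id, fun _ _ h => h, fun _ _ => rfl, fun _ => rfl⟩

def DGHomL.comp {X Y Z : DGModL A} (G : DGHomL Y Z) (F : DGHomL X Y) : DGHomL X Z :=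
  ⟨G.f ∘ₗ F.f, fun j m h => G.deg j _ (F.deg j m h),
    fun x m => by simp [LinearMap.comp_apply, F.actc, G.actc],
    fun m => by simp [LinearMap.comp_apply, F.comm, G.comm]⟩

def HomotopicL {X Y : DGModL A} (F G : DGHomL X Y) : Prop :=
  ∃ h : X.M →ₗ[k] Y.M,
    (∀ (j : ℤ), ∀ m ∈ X.gm j, h m ∈ Y.gm (j - 1)) ∧
    (∀ (i : ℤ) (x : A.R), x ∈ A.gr i → ∀ m : X.M, h (X.actL x m) = sgnz i • Y.actL x (h m)) ∧
    ∀ m : X.M, F.f m - G.f m = Y.D (h m) + h (X.D m)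

def lSpan (X : DGModL A) (S : Set X.M) : Submodule k X.M :=
  sInf {p : Submodule k X.M | S ⊆ ↑p ∧ ∀ (x : A.R) (m : X.M), m ∈ p → X.actL x m ∈ p}

def IsTwistedL (T : DGModL A) : Prop :=
  ∃ (s : ℕ) (r : Fin s → ℤ) (e : Fin s → T.M),
    (∀ j, e j ∈ T.gm (-(r j))) ∧
    (∀ j, T.D (e j) ∈ lSpan T (e '' {i | i < j})) ∧
    Function.Bijective (fun v : Fin s → A.R => ∑ j, T.actL (v j) (e j))

def IsHoSummandL (P T : DGModL A) : Prop :=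
  ∃ (ι : DGHomL P T) (ρ : DGHomL T P), HomotopicL (ρ.comp ι) (DGHomL.id P)

def IsPerfectL (N : DGModL A) : Prop :=
  ∃ T P : DGModL A, IsTwistedL T ∧ IsHoSummandL P T ∧
    ∃ F : DGHomL P N, QIsoData P.gm P.D N.gm N.D F.f

/-- The degree-`n` part of the complex `Hom_A(X, A)` of right `A`-module maps into `A`. -/
def rHomGrade (X : DGMod A) (n : ℤ) : Submodule k (X.M →ₗ[k] A.R) where
  carrier := {g | (∀ (j : ℤ), ∀ m ∈ X.gm j, g m ∈ A.gr (j + n)) ∧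
    ∀ (x : A.R) (m : X.M), g (X.act x m) = g m * x}
  add_mem' := by
    rintro f g ⟨hf1, hf2⟩ ⟨hg1, hg2⟩
    exact ⟨fun j m hm => (A.gr (j + n)).add_mem (hf1 j m hm) (hg1 j m hm),
      fun x m => by simp [hf2, hg2, add_mul]⟩
  zero_mem' := ⟨fun j m hm => (A.gr (j + n)).zero_mem, fun x m => by simp⟩
  smul_mem' := by
    rintro c f ⟨hf1, hf2⟩
    exact ⟨fun j m hm => (A.gr (j + n)).smul_mem c (hf1 j m hm),
      fun x m => by simp [hf2, Algebra.smul_mul_assoc]⟩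

/-- `V` realizes the dual complex `X^∨ = RHom_A(X, A)` of a (homotopically projective)
right DG module `X`, as a left DG module. -/
def IsRightDualOf (X : DGMod A) (V : DGModL A) : Prop :=
  ∃ Φ : V.M →ₗ[k] (X.M →ₗ[k] A.R),
    Function.Injective Φ ∧
    (∀ n : ℤ, Submodule.map Φ (V.gm n) = rHomGrade X n) ∧
    (∀ (n : ℤ), ∀ v ∈ V.gm n, Φ (V.D v) = A.d ∘ₗ Φ v - sgnz n • (Φ v ∘ₗ X.D)) ∧
    ∀ (x : A.R) (v : V.M), Φ (V.actL x v) = LinearMap.mul k A.R x ∘ₗ Φ v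

/-- The degree-`n` part of the complex `Hom_{Aᵒᵖ}(V, A)` of left `A`-module maps into `A`
(with Koszul signs for moving a degree-`n` map past a left action). -/
def lHomGrade (V : DGModL A) (n : ℤ) : Submodule k (V.M →ₗ[k] A.R) where
  carrier := {g | (∀ (j : ℤ), ∀ v ∈ V.gm j, g v ∈ A.gr (j + n)) ∧
    ∀ (i : ℤ) (x : A.R), x ∈ A.gr i → ∀ v : V.M, g (V.actL x v) = sgnz (i * n) • (x * g v)}
  add_mem' := by
    rintro f g ⟨hf1, hf2⟩ ⟨hg1, hg2⟩
    exact ⟨fun j v hv => (A.gr (j + n)).add_mem (hf1 j v hv) (hg1 j v hv),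
      fun i x hx v => by simp [hf2 i x hx, hg2 i x hx, mul_add, smul_add]⟩
  zero_mem' := ⟨fun j v hv => (A.gr (j + n)).zero_mem, fun i x hx v => by simp⟩
  smul_mem' := by
    rintro c f ⟨hf1, hf2⟩
    refine ⟨fun j v hv => (A.gr (j + n)).smul_mem c (hf1 j v hv), fun i x hx v => ?_⟩
    simp only [LinearMap.smul_apply, hf2 i x hx, Algebra.mul_smul_comm]
    rw [smul_comm]

/-- `W` realizes the bidual complex `Hom_{Aᵒᵖ}(V, A)` of a left DG module `V`,
as a right DG module. -/
def IsLeftDualOf (V : DGModL A) (W : DGMod A) : Prop :=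
  ∃ Ψ : W.M →ₗ[k] (V.M →ₗ[k] A.R),
    Function.Injective Ψ ∧
    (∀ n : ℤ, Submodule.map Ψ (W.gm n) = lHomGrade V n) ∧
    (∀ (n : ℤ), ∀ w ∈ W.gm n, Ψ (W.D w) = A.d ∘ₗ Ψ w - sgnz n • (Ψ w ∘ₗ V.D)) ∧
    ∀ (x : A.R) (w : W.M), Ψ (W.act x w) = (LinearMap.mul k A.R).flip x ∘ₗ Ψ w

/-- The degree-`j` part of the graded `k`-linear dual of a graded module:
functionals vanishing on all components of degree `≠ -j`. -/
def dualGrade {M : Type} [AddCommGroup M] [Module k M]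
    (gm : ℤ → Submodule k M) (j : ℤ) : Submodule k (M →ₗ[k] k) where
  carrier := {ν | ∀ l : ℤ, l ≠ -j → ∀ m ∈ gm l, ν m = 0}
  add_mem' := by
    intro f g hf hg l hl m hm
    simp [hf l hl m hm, hg l hl m hm]
  zero_mem' := by intro l hl m hm; simp
  smul_mem' := by
    intro c f hf l hl m hm
    simp [hf l hl m hm]

/-- `W` realizes the graded `k`-linear dual of a left DG module `V`, as a right DG
module (the Nakayama construction `V ↦ V^*`). -/
def IsGradedKDual (V : DGModL A) (W : DGMod A) : Prop :=
  ∃ Ψ : W.M →ₗ[k] (V.M →ₗ[k] k),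
    (∀ (n : ℤ), ∀ w ∈ W.gm n, Ψ w ∈ dualGrade V.gm n) ∧
    (∀ n : ℤ, Function.Bijective
      (fun w : ↥(W.gm n) => (Ψ ↑w) ∘ₗ (V.gm (-n)).subtype)) ∧
    (∀ (n : ℤ), ∀ w ∈ W.gm n, ∀ v : V.M, Ψ (W.D w) v = -(sgnz n) • Ψ w (V.D v)) ∧
    ∀ (i : ℤ) (x : A.R), x ∈ A.gr i → ∀ (n : ℤ), ∀ w ∈ W.gm n, ∀ v : V.M,
      Ψ (W.act x w) v = sgnz (i * n) • Ψ w (V.actL x v)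

/-- `W` realizes the Nakayama functor value `S_A(X) = (X^∨)^*`. -/
def IsNakayamaOf (X : DGMod A) (W : DGMod A) : Prop :=
  ∃ V : DGModL A, IsRightDualOf X V ∧ IsGradedKDual V W
/-! ### Graded tensor products, dual complexes, and bimodule Hom complexes -/

/-- The degree-`n` part of the tensor product of two graded modules. -/
def tenGrade {M₁ M₂ : Type} [AddCommGroup M₁] [Module k M₁] [AddCommGroup M₂] [Module k M₂]
    (gm₁ : ℤ → Submodule k M₁) (gm₂ : ℤ → Submodule k M₂) (n : ℤ) :
    Submodule k (M₁ ⊗[k] M₂) :=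
  Submodule.span k {t : M₁ ⊗[k] M₂ | ∃ (i j : ℤ) (x : M₁) (y : M₂),
    x ∈ gm₁ i ∧ y ∈ gm₂ j ∧ i + j = n ∧ t = x ⊗ₜ y}

/-- The differential `D₁ ⊗ 1 + σ₁ ⊗ D₂` on a tensor product of complexes, where `σ₁`
is the sign operator of the first factor. -/
def tenD {M₁ M₂ : Type} [AddCommGroup M₁] [Module k M₁] [AddCommGroup M₂] [Module k M₂]
    (D₁ : M₁ →ₗ[k] M₁) (s₁ : M₁ →ₗ[k] M₁) (D₂ : M₂ →ₗ[k] M₂) :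
    (M₁ ⊗[k] M₂) →ₗ[k] (M₁ ⊗[k] M₂) :=
  TensorProduct.map D₁ LinearMap.id + TensorProduct.map s₁ D₂

/-- Cycles of a quotient complex `M/K`, described by representatives in `M`. -/
def ZgK {M : Type} [AddCommGroup M] [Module k M]
    (gm : ℤ → Submodule k M) (Dm : M →ₗ[k] M) (K : Submodule k M) (n : ℤ) :
    Submodule k M :=
  gm n ⊓ K.comap Dm

/-- Boundaries of a quotient complex `M/K`, described by representatives in `M`. -/
def BgK {M : Type} [AddCommGroup M] [Module k M]
    (gm : ℤ → Submodule k M) (Dm : M →ₗ[k] M) (K : Submodule k M) (n : ℤ) :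
    Submodule k M :=
  gm n ⊓ (K ⊔ LinearMap.range Dm)

/-- The differential of the graded dual of a complex. -/
def dualD {M : Type} [AddCommGroup M] [Module k M]
    (gm : ℤ → Submodule k M) [DirectSum.Decomposition gm] (Dm : M →ₗ[k] M) :
    (M →ₗ[k] k) →ₗ[k] (M →ₗ[k] k) :=
  -((LinearMap.llcomp k M M k).flip (Dm ∘ₗ gop gm fun j => sgnk k (j + 1)))

/-- The left `A`-action on the dual `M^*` of a right DG `A`-module `M`. -/
def dualActL (M : DGMod A) (x : A.R) : (M.M →ₗ[k] k) →ₗ[k] (M.M →ₗ[k] k) :=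
  (LinearMap.llcomp k M.M M.M k).flip (M.act x)

/-- The relations submodule defining `X ⊗_A V` inside `X ⊗_k V` for a right module `X`
and a bimodule `V`. -/
def tenRelMB (X : DGMod A) (V : DGBimod A) : Submodule k (X.M ⊗[k] V.M) :=
  Submodule.span k {t : X.M ⊗[k] V.M | ∃ (a : A.R) (x : X.M) (v : V.M),
    t = (X.act a x) ⊗ₜ v - x ⊗ₜ (V.actL a v)}

/-- The relations submodule defining `U ⊗_A V` inside `U ⊗_k V` for two bimodules. -/
def tenRelBB (U V : DGBimod A) : Submodule k (U.M ⊗[k] V.M) :=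
  Submodule.span k {t : U.M ⊗[k] V.M | ∃ (a : A.R) (u : U.M) (v : V.M),
    t = (U.actR a u) ⊗ₜ v - u ⊗ₜ (V.actL a v)}

/-- `V` realizes the dual bimodule `A^* = Hom_k(A, k)` (with its canonical DG
`A`-bimodule structure induced from the diagonal bimodule `A`). -/
def IsDualDiagOf {A : DGAlgebra k} (V : DGBimod A) : Prop :=
  ∃ Ψ : V.M →ₗ[k] (A.R →ₗ[k] k),
    (∀ (n : ℤ), ∀ v ∈ V.gm n, Ψ v ∈ dualGrade A.gr n) ∧
    (∀ n : ℤ, Function.Bijective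
      (fun v : ↥(V.gm n) => (Ψ ↑v) ∘ₗ (A.gr (-n)).subtype)) ∧
    (∀ (n : ℤ), ∀ v ∈ V.gm n, ∀ b : A.R, Ψ (V.D v) b = -(sgnz n) • Ψ v (A.d b)) ∧
    (∀ (i : ℤ) (x : A.R), x ∈ A.gr i → ∀ (n : ℤ), ∀ v ∈ V.gm n, ∀ b : A.R,
      Ψ (V.actL x v) b = sgnz (i * n) • Ψ v (b * x)) ∧
    ∀ (x : A.R) (v : V.M) (b : A.R), Ψ (V.actR x v) b = Ψ v (x * b)

/-- The degree-`n` part of the bimodule Hom complex `Hom_{Aᵉ}(P, T)`, for a target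
complex `T` equipped with (degreewise) commuting `Aᵉ`-actions `actLT`, `actRT`. -/
def bheGrade (P : DGBimod A) {T : Type} [AddCommGroup T] [Module k T]
    (gmT : ℤ → Submodule k T) (actLT actRT : ℤ → A.R → T →ₗ[k] T) (n : ℤ) :
    Submodule k (P.M →ₗ[k] T) where
  carrier := {g | (∀ (j : ℤ), ∀ m ∈ P.gm j, g m ∈ gmT (j + n)) ∧
    (∀ (i : ℤ) (x : A.R), x ∈ A.gr i → ∀ m : P.M,
      g (P.actL x m) = sgnz (i * n) • actLT i x (g m)) ∧
    ∀ (i : ℤ) (x : A.R), x ∈ A.gr i → ∀ m : P.M, g (P.actR x m) = actRT i x (g m)}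
  add_mem' := by
    rintro f g ⟨hf1, hf2, hf3⟩ ⟨hg1, hg2, hg3⟩
    exact ⟨fun j m hm => (gmT (j + n)).add_mem (hf1 j m hm) (hg1 j m hm),
      fun i x hx m => by simp [hf2 i x hx, hg2 i x hx, smul_add],
      fun i x hx m => by simp [hf3 i x hx, hg3 i x hx]⟩
  zero_mem' := ⟨fun j m hm => (gmT (j + n)).zero_mem,
    fun i x hx m => by simp, fun i x hx m => by simp⟩
  smul_mem' := by
    rintro c f ⟨hf1, hf2, hf3⟩
    refine ⟨fun j m hm => (gmT (j + n)).smul_mem c (hf1 j m hm), fun i x hx m => ?_,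
      fun i x hx m => by simp [hf3 i x hx]⟩
    simp only [LinearMap.smul_apply, hf2 i x hx, map_smul]
    rw [smul_comm]

/-- The differential of the bimodule Hom complex in degree `n`. -/
def bhDop (P : DGBimod A) {T : Type} [AddCommGroup T] [Module k T]
    (DT : T →ₗ[k] T) (n : ℤ) : (P.M →ₗ[k] T) →ₗ[k] (P.M →ₗ[k] T) :=
  (LinearMap.llcomp k P.M T T) DT - sgnz n • (LinearMap.llcomp k P.M P.M T).flip P.D

/-- Closed degree-`n` elements of the bimodule Hom complex. -/
def ZbhS (P : DGBimod A) {T : Type} [AddCommGroup T] [Module k T]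
    (gmT : ℤ → Submodule k T) (actLT actRT : ℤ → A.R → T →ₗ[k] T)
    (DT : T →ₗ[k] T) (n : ℤ) : Submodule k (P.M →ₗ[k] T) :=
  bheGrade P gmT actLT actRT n ⊓ LinearMap.ker (bhDop P DT n)

/-- Boundaries of degree `n` of the bimodule Hom complex. -/
def BbhS (P : DGBimod A) {T : Type} [AddCommGroup T] [Module k T]
    (gmT : ℤ → Submodule k T) (actLT actRT : ℤ → A.R → T →ₗ[k] T)
    (DT : T →ₗ[k] T) (n : ℤ) : Submodule k (P.M →ₗ[k] T) :=
  Submodule.map (bhDop P DT (n - 1)) (bheGrade P gmT actLT actRT (n - 1))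

/-- Cohomology of the bimodule Hom complex (`Ext` over `Aᵉ`). -/
def ExtBSpace (P : DGBimod A) {T : Type} [AddCommGroup T] [Module k T]
    (gmT : ℤ → Submodule k T) (actLT actRT : ℤ → A.R → T →ₗ[k] T)
    (DT : T →ₗ[k] T) (n : ℤ) : Type :=
  ↥(ZbhS P gmT actLT actRT DT n) ⧸
    (Submodule.comap (ZbhS P gmT actLT actRT DT n).subtype
      (BbhS P gmT actLT actRT DT n ⊓ ZbhS P gmT actLT actRT DT n))

instance (P : DGBimod A) {T : Type} [AddCommGroup T] [Module k T]
    (gmT : ℤ → Submodule k T) (actLT actRT : ℤ → A.R → T →ₗ[k] T)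
    (DT : T →ₗ[k] T) (n : ℤ) : AddCommGroup (ExtBSpace P gmT actLT actRT DT n) := by
  unfold ExtBSpace; infer_instance

instance (P : DGBimod A) {T : Type} [AddCommGroup T] [Module k T]
    (gmT : ℤ → Submodule k T) (actLT actRT : ℤ → A.R → T →ₗ[k] T)
    (DT : T →ₗ[k] T) (n : ℤ) : Module k (ExtBSpace P gmT actLT actRT DT n) := by
  unfold ExtBSpace; infer_instance

/-- The differential of `Aᵉ` on the underlying space `A.R ⊗[k] A.R`. -/
def aeD (A : DGAlgebra k) : (A.R ⊗[k] A.R) →ₗ[k] (A.R ⊗[k] A.R) :=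
  tenD A.d (gop A.gr fun j => sgnk k j) A.d

/-- The inner (module) action of a homogeneous element of degree `i` on the left slot
of the free `Aᵉ`-module `Aᵉ`. -/
def aeInnerL (A : DGAlgebra k) (i : ℤ) (x : A.R) : (A.R ⊗[k] A.R) →ₗ[k] (A.R ⊗[k] A.R) :=
  TensorProduct.map (LinearMap.mulLeft k x) (gop A.gr fun j => sgnk k (i * j))

/-- The inner (module) action on the right slot of the free `Aᵉ`-module `Aᵉ`. -/
def aeInnerR (A : DGAlgebra k) (i : ℤ) (x : A.R) : (A.R ⊗[k] A.R) →ₗ[k] (A.R ⊗[k] A.R) :=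
  TensorProduct.map LinearMap.id (LinearMap.mulRight k x)

/-- The outer left action on the free `Aᵉ`-module `Aᵉ`. -/
def aeOuterL (A : DGAlgebra k) (i : ℤ) (x : A.R) : (A.R ⊗[k] A.R) →ₗ[k] (A.R ⊗[k] A.R) :=
  TensorProduct.map (LinearMap.mulRight k x) LinearMap.id

/-- The outer right action on the free `Aᵉ`-module `Aᵉ`. -/
def aeOuterR (A : DGAlgebra k) (i : ℤ) (x : A.R) : (A.R ⊗[k] A.R) →ₗ[k] (A.R ⊗[k] A.R) :=
  TensorProduct.map (gop A.gr fun j => sgnk k (i * j)) (LinearMap.mulLeft k x)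

/-- `E` represents the inverse dualizing bimodule
`A^! = RHom_{(Aᵉ)ᵒᵖ}(A, (Aᵉ)ᵒᵖ)`: `E` is identified, via `Φ`, with the bimodule Hom
complex `Hom_{Aᵉ}(P, Aᵉ)` for an h-projective bimodule resolution `P` of the diagonal. -/
def RepresentsShriek {A : DGAlgebra k} (E : DGBimod A) : Prop :=
  ∃ (P : DGBimod A) (F : BimodHom P (diagBimod A)), IsDiagResolution P F ∧
  ∃ Φ : E.M →ₗ[k] (P.M →ₗ[k] (A.R ⊗[k] A.R)),
    Function.Injective Φ ∧
    (∀ n : ℤ, Submodule.map Φ (E.gm n) =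
      bheGrade P (tenGrade A.gr A.gr) (aeInnerL A) (aeInnerR A) n) ∧
    (∀ (n : ℤ), ∀ v ∈ E.gm n, Φ (E.D v) = bhDop P (aeD A) n (Φ v)) ∧
    (∀ (i : ℤ) (x : A.R), x ∈ A.gr i → ∀ v : E.M,
      Φ (E.actL x v) = aeOuterL A i x ∘ₗ Φ v) ∧
    ∀ (i : ℤ) (x : A.R), x ∈ A.gr i → ∀ v : E.M,
      Φ (E.actR x v) = aeOuterR A i x ∘ₗ Φ v

namespace PIF

section Graded
variable {M : Type} [AddCommGroup M] [Module k M] (gm : ℤ → Submodule k M)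
  [DirectSum.Decomposition gm] {Q : Type} [AddCommGroup Q] [Module k Q]

def glue (φ : ℤ → M →ₗ[k] Q) : M →ₗ[k] Q :=
  (DirectSum.toModule k ℤ Q (fun j => (φ j) ∘ₗ (gm j).subtype)) ∘ₗ
    (DirectSum.decomposeLinearEquiv gm).toLinearMap

lemma glue_mem (φ : ℤ → M →ₗ[k] Q) {i : ℤ} {m : M} (hm : m ∈ gm i) :
    glue gm φ m = φ i m := by
  simp only [glue, LinearMap.comp_apply, LinearEquiv.coe_coe, decomposeLinearEquiv_apply]
  rw [DirectSum.decompose_of_mem gm hm]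
  erw [DirectSum.toModule_lof]
  rfl

lemma gop_mem (c : ℤ → k) {i : ℤ} {m : M} (hm : m ∈ gm i) : gop gm c m = c i • m := by
  simp only [gop, LinearMap.comp_apply, LinearEquiv.coe_coe, decomposeLinearEquiv_apply]
  rw [DirectSum.decompose_of_mem gm hm]
  erw [DirectSum.toModule_lof]
  rfl

lemma gr_induct {p : M → Prop} (h0 : p 0) (hadd : ∀ x y, p x → p y → p (x + y))
    (hh : ∀ i, ∀ m ∈ gm i, p m) (m : M) : p m :=
  DirectSum.Decomposition.inductionOn gm h0 (fun {i} m => hh i m m.2) (fun x y => hadd x y) m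

lemma gr_ext {f g : M →ₗ[k] Q} (h : ∀ i, ∀ m ∈ gm i, f m = g m) : f = g := by
  ext m
  refine gr_induct gm (p := fun m => f m = g m) (by simp) ?_ h m
  intro x y hx hy
  rw [map_add, map_add, hx, hy]

def pr (n : ℤ) : M →ₗ[k] M := glue gm (fun i => if i = n then LinearMap.id else 0)

lemma pr_same {n : ℤ} {m : M} (hm : m ∈ gm n) : pr gm n m = m := by
  simp [pr, glue_mem gm _ hm]

lemma pr_ne {i n : ℤ} (h : i ≠ n) {m : M} (hm : m ∈ gm i) : pr gm n m = 0 := by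
  simp [pr, glue_mem gm _ hm, h]

lemma pr_mem (n : ℤ) (m : M) : pr gm n m ∈ gm n := by
  refine gr_induct gm (p := fun m => pr gm n m ∈ gm n) (by simp) ?_ ?_ m
  · intro x y hx hy
    rw [map_add]; exact add_mem hx hy
  · intro i m hm
    by_cases h : i = n
    · subst h; rwa [pr_same gm hm]
    · rw [pr_ne gm h hm]; exact zero_mem _

lemma pr_sum (m : M) : ∃ S : Finset ℤ, m = ∑ i ∈ S, pr gm i m := by
  classical
  have key : ∃ S : Finset ℤ, ∀ T, S ⊆ T → m = ∑ i ∈ T, pr gm i m := by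
    refine gr_induct gm (p := fun m => ∃ S : Finset ℤ, ∀ T, S ⊆ T → m = ∑ i ∈ T, pr gm i m)
      ⟨∅, by simp⟩ ?_ ?_ m
    · rintro x y ⟨S, hS⟩ ⟨S', hS'⟩
      refine ⟨S ∪ S', fun T hT => ?_⟩
      simp only [map_add, Finset.sum_add_distrib]
      rw [← hS T (Finset.union_subset_left hT), ← hS' T (Finset.union_subset_right hT)]
    · intro i m hm
      refine ⟨{i}, fun T hT => ?_⟩
      rw [Finset.sum_eq_single i, pr_same gm hm]
      · intro j _ hj
        exact pr_ne gm hj.symm hm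
      · intro h; exact absurd (hT (by simp)) h
  obtain ⟨S, hS⟩ := key
  exact ⟨S, hS S subset_rfl⟩

/-- `G` has degree `e`. -/
def HasDeg (gm' : ℤ → Submodule k Q) (G : M →ₗ[k] Q) (e : ℤ) : Prop :=
  ∀ j, ∀ m ∈ gm j, G m ∈ gm' (j + e)

variable {gm} in
lemma HasDeg.comm {gm' : ℤ → Submodule k Q} [DirectSum.Decomposition gm'] {G : M →ₗ[k] Q} {e : ℤ}
    (h : HasDeg gm gm' G e) (n : ℤ) (m : M) : G (pr gm n m) = pr gm' (n + e) (G m) := by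
  have : G ∘ₗ pr gm n = pr gm' (n + e) ∘ₗ G := by
    apply gr_ext gm
    intro i m hm
    by_cases hi : i = n
    · subst hi
      simp [pr_same gm hm, pr_same gm' (h _ m hm)]
    · simp [pr_ne gm hi hm, pr_ne gm' (show i + e ≠ n + e by omega) (h _ m hm)]
  exact LinearMap.congr_fun this m

/-- Degree can be checked on a spanning set of homogeneous elements. -/
lemma HasDeg.of_span {gm' : ℤ → Submodule k Q} [DirectSum.Decomposition gm'] {G : M →ₗ[k] Q} {e : ℤ}
    (S : Set M) (hS : Submodule.span k S = ⊤)
    (h : ∀ x ∈ S, ∃ i, x ∈ gm i ∧ G x ∈ gm' (i + e)) : HasDeg gm gm' G e := by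
  have key : ∀ n, G ∘ₗ pr gm n = pr gm' (n + e) ∘ₗ G := by
    intro n
    apply LinearMap.ext_on hS
    intro x hx
    obtain ⟨i, hi, hG⟩ := h x hx
    by_cases hin : i = n
    · subst hin
      simp [pr_same gm hi, pr_same gm' hG]
    · simp [pr_ne gm hin hi, pr_ne gm' (show i + e ≠ n + e by omega) hG]
  intro n m hm
  have := LinearMap.congr_fun (key n) m
  simp only [LinearMap.comp_apply, pr_same gm hm] at this
  rw [this]; exact pr_mem _ _ _

end Graded

/-- A decomposition from projections. -/
@[reducible]
def decompOfProj {M : Type} [AddCommGroup M] [Module k M] (gm : ℤ → Submodule k M)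
    (π : ℤ → M →ₗ[k] M) (h1 : ∀ i, ∀ m ∈ gm i, π i m = m)
    (h2 : ∀ i j, i ≠ j → ∀ m ∈ gm i, π j m = 0) (h3 : (⨆ i, gm i) = ⊤) :
    DirectSum.Decomposition gm :=
  DirectSum.IsInternal.chooseDecomposition gm (by
    rw [DirectSum.isInternal_submodule_iff_iSupIndep_and_iSup_eq_top]
    refine ⟨?_, h3⟩
    rw [iSupIndep_def]
    intro i
    rw [Submodule.disjoint_def]
    intro x hx hx'
    rw [← h1 i x hx]
    have : (⨆ j, ⨆ (_ : j ≠ i), gm j) ≤ LinearMap.ker (π i) := by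
      refine iSup_le fun j => iSup_le fun hj => ?_
      intro y hy
      exact h2 j i hj y hy
    exact this hx')

/-! signs -/
lemma sgnk_sq (i : ℤ) : sgnk k i * sgnk k i = 1 := by unfold sgnk; split <;> simp
lemma sgnk_succ (i : ℤ) : sgnk k (i + 1) = - sgnk k i := by
  unfold sgnk; simp only [Int.even_add_one]; split <;> simp_all
lemma sgnk_pred (i : ℤ) : sgnk k (i - 1) = - sgnk k i := by
  have := sgnk_succ (k := k) (i - 1); rw [sub_add_cancel] at this; rw [this, neg_neg]
lemma sgnk_add (i j : ℤ) : sgnk k (i + j) = sgnk k i * sgnk k j := by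
  unfold sgnk; simp only [Int.even_add]
  by_cases h : Even i <;> by_cases h' : Even j <;> simp [h, h']
lemma sgnz_smul {M : Type} [AddCommGroup M] [Module k M] (i : ℤ) (m : M) :
    sgnz i • m = sgnk k i • m := by
  unfold sgnk sgnz; split <;> simp

section Eps
variable {M : Type} [AddCommGroup M] [Module k M] (gm : ℤ → Submodule k M)
  [DirectSum.Decomposition gm]

def eps : M →ₗ[k] M := gop gm (sgnk k)

lemma eps_mem {i : ℤ} {m : M} (hm : m ∈ gm i) : eps gm m = sgnk k i • m := gop_mem gm _ hm

lemma eps_eps (m : M) : eps gm (eps gm m) = m := by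
  have : eps gm ∘ₗ eps gm = LinearMap.id := by
    apply gr_ext gm
    intro i m hm
    simp [eps_mem gm hm, smul_smul, sgnk_sq]
  exact LinearMap.congr_fun this m

lemma eps_deg : HasDeg gm gm (eps gm) 0 := by
  intro j m hm
  rw [eps_mem gm hm, add_zero]; exact Submodule.smul_mem _ _ hm

variable {gm} in
lemma eps_anti {Q : Type} [AddCommGroup Q] [Module k Q] {gm' : ℤ → Submodule k Q}
    [DirectSum.Decomposition gm'] {G : M →ₗ[k] Q} (h : HasDeg gm gm' G 1) (m : M) :
    eps gm' (G m) = - G (eps gm m) := by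
  have : eps gm' ∘ₗ G = - (G ∘ₗ eps gm) := by
    apply gr_ext gm
    intro i m hm
    simp [eps_mem gm hm, eps_mem gm' (h _ m hm), sgnk_succ]
  exact LinearMap.congr_fun this m

variable {gm} in
lemma eps_anti' {Q : Type} [AddCommGroup Q] [Module k Q] {gm' : ℤ → Submodule k Q}
    [DirectSum.Decomposition gm'] {G : M →ₗ[k] Q} (h : HasDeg gm gm' G (-1)) (m : M) :
    eps gm' (G m) = - G (eps gm m) := by
  have : eps gm' ∘ₗ G = - (G ∘ₗ eps gm) := by
    apply gr_ext gm
    intro i m hm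
    have h1 := h _ m hm
    rw [← sub_eq_add_neg] at h1
    simp [eps_mem gm hm, eps_mem gm' h1, sgnk_pred]
  exact LinearMap.congr_fun this m

variable {gm} in
lemma eps_comm {Q : Type} [AddCommGroup Q] [Module k Q] {gm' : ℤ → Submodule k Q}
    [DirectSum.Decomposition gm'] {G : M →ₗ[k] Q} (h : ∀ j, ∀ m ∈ gm j, G m ∈ gm' j) (m : M) :
    eps gm' (G m) = G (eps gm m) := by
  have : eps gm' ∘ₗ G = (G ∘ₗ eps gm) := by
    apply gr_ext gm
    intro i m hm
    simp [eps_mem gm hm, eps_mem gm' (h _ m hm)]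
  exact LinearMap.congr_fun this m
end Eps

/-! ε on algebras and modules -/
def ea (A : DGAlgebra k) : A.R →ₗ[k] A.R := eps A.gr

lemma ea_ea (a : A.R) : ea A (ea A a) = a := eps_eps _ a

lemma ea_d (a : A.R) : ea A (A.d a) = - A.d (ea A a) := eps_anti (gm := A.gr) A.d_deg a

lemma d_ea (a : A.R) : A.d (ea A a) = - ea A (A.d a) := by rw [ea_d, neg_neg]

/-- bilinear homogeneous extension -/
lemma gr_ext₂ {M M' Q : Type} [AddCommGroup M] [Module k M] [AddCommGroup M'] [Module k M']
    [AddCommGroup Q] [Module k Q] (gm : ℤ → Submodule k M) [DirectSum.Decomposition gm]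
    (gm' : ℤ → Submodule k M') [DirectSum.Decomposition gm'] {f g : M →ₗ[k] M' →ₗ[k] Q}
    (h : ∀ i, ∀ m ∈ gm i, ∀ j, ∀ n ∈ gm' j, f m n = g m n) : f = g :=
  gr_ext gm fun i m hm => gr_ext gm' fun j n hn => h i m hm j n hn

lemma ea_mul (a b : A.R) : ea A (a * b) = ea A a * ea A b := by
  have : (LinearMap.mul k A.R).compr₂ (ea A) = (LinearMap.mul k A.R).compl₁₂ (ea A) (ea A) := by
    apply gr_ext₂ A.gr A.gr
    intro i a ha j b hb
    simp [ea, eps_mem A.gr ha, eps_mem A.gr hb, eps_mem A.gr (A.mul_mem ha hb), sgnk_add,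
      smul_smul, mul_comm]
  exact LinearMap.congr_fun₂ this a b

lemma ea_one : ea A 1 = 1 := by
  simp [ea, eps_mem A.gr A.one_mem, sgnk]

lemma d_mul (a b : A.R) : A.d (a * b) = A.d a * b + ea A a * A.d b := by
  have : (LinearMap.mul k A.R).compr₂ A.d =
      (LinearMap.mul k A.R).compl₁₂ A.d LinearMap.id +
      (LinearMap.mul k A.R).compl₁₂ (ea A) A.d := by
    apply gr_ext₂ A.gr A.gr
    intro i a ha j b hb
    simp [ea, eps_mem A.gr ha, A.leibniz i a ha, sgnz_smul (k := k)]
  exact LinearMap.congr_fun₂ this a b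

lemma d_one : A.d 1 = 0 := by
  have := d_mul (A := A) 1 1
  rw [ea_one] at this
  simpa using this

lemma mod_leib (N : DGMod A) (a : A.R) (n : N.M) :
    N.D (N.act a n) = N.act a (N.D n) + N.act (A.d a) (eps N.gm n) := by
  have : N.act.compr₂ N.D = N.act.compl₁₂ LinearMap.id N.D + N.act.compl₁₂ A.d (eps N.gm) := by
    apply gr_ext₂ A.gr N.gm
    intro i a ha j b hb
    simp [eps_mem N.gm hb, N.leibniz i j a b ha hb, sgnz_smul (k := k)]
  exact LinearMap.congr_fun₂ this a n

lemma mod_eps (N : DGMod A) (a : A.R) (n : N.M) :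
    eps N.gm (N.act a n) = N.act (ea A a) (eps N.gm n) := by
  have : N.act.compr₂ (eps N.gm) = N.act.compl₁₂ (ea A) (eps N.gm) := by
    apply gr_ext₂ A.gr N.gm
    intro i a ha j b hb
    simp [ea, eps_mem N.gm hb, eps_mem A.gr ha, eps_mem N.gm (N.act_deg i j a b ha hb), sgnk_add,
      smul_smul]
  exact LinearMap.congr_fun₂ this a n

lemma mod_eps_D (N : DGMod A) (n : N.M) : eps N.gm (N.D n) = - N.D (eps N.gm n) :=
  eps_anti (gm := N.gm) N.D_deg n

lemma bi_eps_D (V : DGBimod A) (n : V.M) : eps V.gm (V.D n) = - V.D (eps V.gm n) :=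
  eps_anti (gm := V.gm) V.D_deg n

lemma bi_leibL (V : DGBimod A) (a : A.R) (v : V.M) :
    V.D (V.actL a v) = V.actL (A.d a) v + V.actL (ea A a) (V.D v) := by
  have : V.actL.compr₂ V.D = V.actL.compl₁₂ A.d LinearMap.id + V.actL.compl₁₂ (ea A) V.D := by
    apply gr_ext₂ A.gr V.gm
    intro i a ha j b hb
    simp [ea, eps_mem A.gr ha, V.leibnizL i j a b ha hb, sgnz_smul (k := k)]
  exact LinearMap.congr_fun₂ this a v

lemma bi_leibR (V : DGBimod A) (a : A.R) (v : V.M) :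
    V.D (V.actR a v) = V.actR a (V.D v) + V.actR (A.d a) (eps V.gm v) := by
  have : V.actR.compr₂ V.D = V.actR.compl₁₂ LinearMap.id V.D + V.actR.compl₁₂ A.d (eps V.gm) := by
    apply gr_ext₂ A.gr V.gm
    intro i a ha j b hb
    simp [eps_mem V.gm hb, V.leibnizR i j a b ha hb, sgnz_smul (k := k)]
  exact LinearMap.congr_fun₂ this a v

end PIF

namespace PIF
section Lin
variable {M : Type} [AddCommGroup M] [Module k M]

def GrFin (gm : ℤ → Submodule k M) (D : M →ₗ[k] M) : Prop :=
  (∀ n : ℤ, FiniteDimensional k (Hg gm D n)) ∧ {n : ℤ | ¬ Subsingleton (Hg gm D n)}.Finite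

def HgEquiv (gm : ℤ → Submodule k M) (D : M →ₗ[k] M) (n : ℤ) :
    Hg gm D n ≃ₗ[k] (↥(Zg gm D n) ⧸ (Submodule.comap (Zg gm D n).subtype (Bg gm D n))) :=
  LinearEquiv.refl k _

lemma exists_q (D : M →ₗ[k] M) : ∃ q : M →ₗ[k] M, ∀ m, D (q (D m)) = D m := by
  obtain ⟨g, hg⟩ := LinearMap.exists_rightInverse_of_surjective D.rangeRestrict
    (LinearMap.range_eq_top.2 D.surjective_rangeRestrict)
  obtain ⟨q, hq⟩ := LinearMap.exists_extend g
  refine ⟨q, fun m => ?_⟩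
  have h1 : q (D m) = g ⟨D m, ⟨m, rfl⟩⟩ := LinearMap.congr_fun hq ⟨D m, ⟨m, rfl⟩⟩
  have h2 := LinearMap.congr_fun hg ⟨D m, ⟨m, rfl⟩⟩
  rw [h1]
  exact congrArg Subtype.val h2

/-- acyclic complexes over a field are contractible -/
lemma exists_contraction (D : M →ₗ[k] M) (hD : ∀ m, D (D m) = 0)
    (hac : ∀ m, D m = 0 → ∃ y, D y = m) : ∃ c : M →ₗ[k] M, ∀ m, D (c m) + c (D m) = m := by
  obtain ⟨q, hq⟩ := exists_q D
  refine ⟨q ∘ₗ (LinearMap.id - q ∘ₗ D), fun m => ?_⟩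
  obtain ⟨y, hy⟩ := hac (m - q (D m)) (by rw [map_sub, hq, sub_self])
  have : D (q (m - q (D m))) = m - q (D m) := by rw [← hy, hq]
  simp only [LinearMap.comp_apply, LinearMap.sub_apply, LinearMap.id_apply, this, hD, map_zero,
    sub_zero, sub_add_cancel]

lemma GrFin.of_fin (gm : ℤ → Submodule k M) [DirectSum.Decomposition gm] (D : M →ₗ[k] M)
    (hdeg : HasDeg gm gm D 1) (hD : ∀ m, D (D m) = 0) (W : Submodule k M)
    (hW : FiniteDimensional k W) (h : ∀ m, D m = 0 → m ∈ W ⊔ LinearMap.range D) :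
    GrFin gm D := by
  classical
  have hB : ∀ n, ∀ m ∈ gm n, m ∈ LinearMap.range D → m ∈ Bg gm D n := fun n m h1 h2 => ⟨h1, h2⟩
  constructor
  · intro n
    let f : ↥(Zg gm D n) →ₗ[k] (M ⧸ LinearMap.range D) :=
      (LinearMap.range D).mkQ ∘ₗ (Zg gm D n).subtype
    have hker : LinearMap.ker f = Submodule.comap (Zg gm D n).subtype (Bg gm D n) := by
      ext z
      simp only [f, LinearMap.ker_comp, Submodule.ker_mkQ, Submodule.mem_comap]
      exact ⟨fun hz => hB n _ z.2.1 hz, fun hz => hz.2⟩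
    have hr : LinearMap.range f ≤ W.map (LinearMap.range D).mkQ := by
      rintro _ ⟨z, rfl⟩
      obtain ⟨w, hw, y, hy, hz⟩ := Submodule.mem_sup.1 (h z z.2.2)
      refine ⟨w, hw, ?_⟩
      simp only [f, LinearMap.comp_apply, Submodule.subtype_apply, ← hz, map_add]
      rw [(Submodule.Quotient.mk_eq_zero _).2 hy |> fun h => (show (LinearMap.range D).mkQ y = 0 from h),
        add_zero]
    have : FiniteDimensional k (LinearMap.range f) :=
      Submodule.finiteDimensional_of_le hr
    have e1 := (Submodule.quotEquivOfEq _ _ hker).symm.trans f.quotKerEquivRange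
    have e2 := (HgEquiv gm D n).trans e1
    exact Module.Finite.equiv e2.symm
  · obtain ⟨s, hs⟩ := (Submodule.fg_iff_finiteDimensional W).2 hW
    choose S hS using pr_sum gm
    refine (s.biUnion S).finite_toSet.subset ?_
    intro n hn
    by_contra hns
    apply hn
    have hpr : ∀ w ∈ W, pr gm n w = 0 := by
      intro w hw
      have : W ≤ LinearMap.ker (pr gm n) := by
        rw [← hs, Submodule.span_le]
        intro x hx
        simp only [SetLike.mem_coe, LinearMap.mem_ker]
        rw [hS x, map_sum]
        apply Finset.sum_eq_zero
        intro i hi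
        apply pr_ne gm _ (pr_mem gm i x)
        rintro rfl
        exact hns (by simpa using ⟨x, hx, hi⟩)
      exact this hw
    have : Subsingleton (↥(Zg gm D n) ⧸ (Submodule.comap (Zg gm D n).subtype (Bg gm D n))) := by
      rw [Submodule.Quotient.subsingleton_iff, eq_top_iff]
      rintro z -
      refine hB n _ z.2.1 ?_
      obtain ⟨w, hw, y, ⟨y', rfl⟩, hz⟩ := Submodule.mem_sup.1 (h z z.2.2)
      have h1 := pr_same gm z.2.1
      rw [← hz, map_add, hpr w hw, zero_add] at h1
      have h2 := hdeg.comm (n - 1) y'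
      rw [sub_add_cancel] at h2
      refine ⟨pr gm (n - 1) y', ?_⟩
      rw [h2, h1, hz]; rfl
    exact (HgEquiv gm D n).toEquiv.subsingleton

/-- graded strong deformation retract data (without finiteness) -/
lemma exists_sdr0 (gm : ℤ → Submodule k M) [DirectSum.Decomposition gm] (D : M →ₗ[k] M)
    (hdeg : HasDeg gm gm D 1) (hD : ∀ m, D (D m) = 0) :
    ∃ c : M →ₗ[k] M, HasDeg gm gm c (-1) ∧ (∀ m, c (c m) = 0) ∧ (∀ m, c (D (c m)) = c m) ∧
      (∀ m, D (c (D m)) = D m) := by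
  obtain ⟨q0, hq0⟩ := exists_q D
  let q1 : M →ₗ[k] M := glue gm (fun n => pr gm (n - 1) ∘ₗ q0)
  have hq1d : HasDeg gm gm q1 (-1) := by
    intro n m hm
    simp only [q1, glue_mem gm _ hm]
    exact pr_mem _ _ _
  have hq1 : ∀ m, D (q1 (D m)) = D m := by
    have : D ∘ₗ q1 ∘ₗ D = D := by
      apply gr_ext gm
      intro n m hm
      have h1 : q1 (D m) = pr gm n (q0 (D m)) := by
        simp only [q1, glue_mem gm _ (hdeg n m hm), add_sub_cancel_right, LinearMap.comp_apply]
      simp only [LinearMap.comp_apply, h1]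
      rw [hdeg.comm, hq0, pr_same gm (hdeg n m hm)]
    exact fun m => LinearMap.congr_fun this m
  let q : M →ₗ[k] M := q1 ∘ₗ D ∘ₗ q1
  have hqa : ∀ m, D (q (D m)) = D m := fun m => by simp [q, hq1]
  have hqb : ∀ m, q (D (q m)) = q m := fun m => by simp [q, hq1]
  have hqd : HasDeg gm gm q (-1) := by
    intro n m hm
    have := hq1d _ _ (hdeg _ _ (hq1d _ _ hm))
    simp only [neg_add_cancel_right] at this
    exact this
  refine ⟨q ∘ₗ (LinearMap.id - q ∘ₗ D), ?_, ?_, ?_, ?_⟩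
  · intro n m hm
    refine hqd _ _ (sub_mem hm ?_)
    have := hqd _ _ (hdeg _ _ hm)
    simpa using this
  · intro m
    simp [hqb]
  · intro m
    simp [hqa, hqb, hD]
  · intro m
    simp [hqa, hqb, hD]

/-- homotopy retract data onto a finite-dimensional space of cocycles -/
structure SDR (gm : ℤ → Submodule k M) (D : M →ₗ[k] M) where
  c : M →ₗ[k] M
  c_deg : HasDeg gm gm c (-1)
  cc : ∀ m, c (c m) = 0
  cDc : ∀ m, c (D (c m)) = c m
  r : ℕ
  deg : Fin r → ℤ
  h : Fin r → M
  lam : Fin r → M →ₗ[k] k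
  h_mem : ∀ l, h l ∈ gm (deg l)
  Dh : ∀ l, D (h l) = 0
  lam_h : ∀ l m, lam l (h m) = if l = m then 1 else 0
  proj : ∀ m, m - D (c m) - c (D m) = ∑ l, lam l m • h l

lemma exists_sdr (gm : ℤ → Submodule k M) [DirectSum.Decomposition gm] (D : M →ₗ[k] M)
    (hdeg : HasDeg gm gm D 1) (hD : ∀ m, D (D m) = 0) (hfin : GrFin gm D) :
    Nonempty (SDR gm D) := by
  classical
  obtain ⟨c, c_deg, cc, cDc, DcD⟩ := exists_sdr0 gm D hdeg hD
  let p : M →ₗ[k] M := LinearMap.id - D ∘ₗ c - c ∘ₗ D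
  have pdef : ∀ m, p m = m - D (c m) - c (D m) := fun m => rfl
  have pp : ∀ m, p (p m) = p m := by
    intro m; simp [pdef, cc, cDc, DcD, hD]
  have Dp : ∀ m, D (p m) = 0 := by
    intro m; simp [pdef, DcD, hD]
  have pD : ∀ m, p (D m) = 0 := by
    intro m; simp [pdef, DcD, hD]
  have pdeg : HasDeg gm gm p 0 := by
    intro n m hm
    rw [add_zero, pdef]
    have h1 := c_deg _ _ (hdeg _ _ hm)
    have h2 := hdeg _ _ (c_deg _ _ hm)
    simp only [add_neg_cancel_right, neg_add_cancel_right] at h1 h2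
    exact sub_mem (sub_mem hm h2) h1
  let H := LinearMap.range p
  have pH : ∀ x ∈ H, p x = x := by rintro _ ⟨y, rfl⟩; exact pp y
  let Hn : ℤ → Submodule k M := fun n => H ⊓ gm n
  -- map to cohomology
  have hinj : ∀ n, ∃ f : Hn n →ₗ[k] (↥(Zg gm D n) ⧸ (Submodule.comap (Zg gm D n).subtype (Bg gm D n))),
      Function.Injective f := by
    intro n
    have hle : Hn n ≤ Zg gm D n := fun x hx => ⟨hx.2, by
      have := Dp x
      rwa [pH x hx.1] at this⟩
    refine ⟨Submodule.mkQ _ ∘ₗ Submodule.inclusion hle, ?_⟩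
    rw [← LinearMap.ker_eq_bot, LinearMap.ker_comp, Submodule.ker_mkQ, eq_bot_iff]
    rintro x hx
    obtain ⟨y, hy⟩ := hx.2
    have : (x : M) = 0 := by
      rw [← pH x x.2.1]
      have hy' : D y = x := hy
      rw [← hy', pD]
    exact Subtype.ext this
  have hfd : ∀ n, FiniteDimensional k (Hn n) := by
    intro n
    obtain ⟨f, hf⟩ := hinj n
    have := hfin.1 n
    have : FiniteDimensional k (↥(Zg gm D n) ⧸ (Submodule.comap (Zg gm D n).subtype (Bg gm D n))) :=
      Module.Finite.equiv (HgEquiv gm D n)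
    exact FiniteDimensional.of_injective f hf
  have hz : ∀ n, n ∉ hfin.2.toFinset → Hn n = ⊥ := by
    intro n hn
    obtain ⟨f, hf⟩ := hinj n
    have hs : Subsingleton (Hg gm D n) := by simpa using hn
    have : Subsingleton (↥(Zg gm D n) ⧸ (Submodule.comap (Zg gm D n).subtype (Bg gm D n))) :=
      (HgEquiv gm D n).symm.toEquiv.subsingleton
    have := hf.subsingleton
    exact Submodule.subsingleton_iff_eq_bot.1 this
  have hprH : ∀ n, ∀ x ∈ H, pr gm n x ∈ Hn n := by
    intro n x hx
    refine ⟨⟨pr gm n x, ?_⟩, pr_mem _ _ _⟩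
    have := pdeg.comm n x
    rw [add_zero, pH x hx] at this
    exact this
  have hHle : H ≤ ⨆ n ∈ hfin.2.toFinset, Hn n := by
    intro x hx
    obtain ⟨S, hS⟩ := pr_sum gm x
    rw [hS]
    refine sum_mem fun n _ => ?_
    by_cases hn : n ∈ hfin.2.toFinset
    · exact Submodule.mem_iSup_of_mem n (Submodule.mem_iSup_of_mem hn (hprH n x hx))
    · have := hprH n x hx
      rw [hz n hn, Submodule.mem_bot] at this
      rw [this]; exact zero_mem _
  have hHfd : FiniteDimensional k H := by
    have : FiniteDimensional k ↥(⨆ n ∈ hfin.2.toFinset, Hn n) :=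
      Submodule.finiteDimensional_finset_sup _ _ |> fun h => by
        rwa [Finset.sup_eq_iSup] at h
    exact Submodule.finiteDimensional_of_le hHle
  -- grading on H
  let gH : ℤ → Submodule k H := fun n => (gm n).comap H.subtype
  have hint : DirectSum.IsInternal gH := by
    let pH' : ℤ → H →ₗ[k] H := fun n => (pr gm n ∘ₗ H.subtype).codRestrict H
      (fun x => (hprH n x x.2).1)
    let := decompOfProj gH pH'
      (fun i m hm => Subtype.ext (pr_same gm hm))
      (fun i j hij m hm => Subtype.ext (pr_ne gm hij hm))
      (by
        rw [eq_top_iff]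
        rintro x -
        obtain ⟨S, hS⟩ := pr_sum gm (x : M)
        have : x = ∑ i ∈ S, pH' i x := by
          apply Subtype.ext
          rw [Submodule.coe_sum]
          exact hS
        rw [this]
        exact sum_mem fun n _ => Submodule.mem_iSup_of_mem n (pr_mem gm n x))
    exact DirectSum.Decomposition.isInternal gH
  let b := hint.collectedBasis (fun i => Module.Basis.ofVectorSpace k (gH i))
  have : Finite (Σ i, ↑(Module.Basis.ofVectorSpaceIndex k (gH i))) := Module.Finite.finite_basis b
  let := Fintype.ofFinite (Σ i, ↑(Module.Basis.ofVectorSpaceIndex k (gH i)))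
  let e := Fintype.equivFin (Σ i, ↑(Module.Basis.ofVectorSpaceIndex k (gH i)))
  let b' := b.reindex e
  refine ⟨⟨c, c_deg, cc, cDc, _, fun l => (e.symm l).1, fun l => (b' l : M),
    fun l => b'.coord l ∘ₗ p.rangeRestrict, ?_, ?_, ?_, ?_⟩⟩
  · intro l
    have := hint.collectedBasis_mem (fun i => Module.Basis.ofVectorSpace k (gH i)) (e.symm l)
    have h2 : b' l = b (e.symm l) := by simp [b']
    show (b' l : M) ∈ gm (e.symm l).1
    rw [h2]
    exact this
  · intro l
    rw [← pH _ (b' l).2]; exact Dp _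
  · intro l m
    have : p.rangeRestrict (b' m : M) = b' m := Subtype.ext (pH _ (b' m).2)
    simp only [LinearMap.comp_apply, this, Module.Basis.coord_apply, Module.Basis.repr_self,
      Finsupp.single_apply, eq_comm]
  · intro m
    have := congrArg (Subtype.val) (b'.sum_repr (p.rangeRestrict m))
    rw [← pdef]
    simp only [Submodule.coe_sum, Submodule.coe_smul] at this
    exact this.symm
end Lin
end PIF

namespace PIF
section Q
variable {M₁ M₂ : Type} [AddCommGroup M₁] [Module k M₁] [AddCommGroup M₂] [Module k M₂]
    {gm₁ : ℤ → Submodule k M₁} [DirectSum.Decomposition gm₁] {D₁ : M₁ →ₗ[k] M₁}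
    {gm₂ : ℤ → Submodule k M₂} [DirectSum.Decomposition gm₂] {D₂ : M₂ →ₗ[k] M₂} {f : M₁ →ₗ[k] M₂}

lemma qis_surj (h2 : HasDeg gm₂ gm₂ D₂ 1) (h : QIsoData gm₁ D₁ gm₂ D₂ f) (z : M₂) (hz : D₂ z = 0) :
    ∃ w, D₁ w = 0 ∧ ∃ y, f w - z = D₂ y := by
  have key : ∀ n, ∃ w, D₁ w = 0 ∧ ∃ y, f w - pr gm₂ n z = D₂ y := by
    intro n
    obtain ⟨w, hw, hw', y, hy⟩ := (h.2.2 n).1 (pr gm₂ n z) ⟨pr_mem _ _ _, by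
      have := h2.comm n z
      rw [hz, map_zero] at this
      exact this⟩
    exact ⟨w, hw.2, y, hy.symm⟩
  choose w hw y hy using key
  obtain ⟨S, hS⟩ := pr_sum gm₂ z
  refine ⟨∑ i ∈ S, w i, by simp [hw], ∑ i ∈ S, y i, ?_⟩
  rw [map_sum, map_sum]
  nth_rewrite 1 [hS]
  rw [← Finset.sum_sub_distrib]
  exact Finset.sum_congr rfl fun i _ => hy i

lemma qis_inj (h1 : HasDeg gm₁ gm₁ D₁ 1) (h2 : HasDeg gm₂ gm₂ D₂ 1)
    (hf : ∀ j, ∀ m ∈ gm₁ j, f m ∈ gm₂ j)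
    (h : QIsoData gm₁ D₁ gm₂ D₂ f) (w : M₁) (hw : D₁ w = 0) (y : M₂) (hy : f w = D₂ y) :
    ∃ y', w = D₁ y' := by
  have hf' : HasDeg gm₁ gm₂ f 0 := fun j m hm => by rw [add_zero]; exact hf j m hm
  have key : ∀ n, ∃ y', pr gm₁ n w = D₁ y' := by
    intro n
    obtain ⟨_, y', hy'⟩ := (h.2.2 n).2 (pr gm₁ n w) ⟨pr_mem _ _ _, by
      have := h1.comm n w
      rw [hw, map_zero] at this
      exact this⟩ ⟨hf n _ (pr_mem _ _ _), pr gm₂ (n - 1) y, by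
        have h3 := hf'.comm n w
        have h4 := h2.comm (n - 1) y
        rw [add_zero] at h3
        rw [sub_add_cancel] at h4
        rw [h3, h4, hy]⟩
    exact ⟨y', hy'.symm⟩
  choose y hy using key
  obtain ⟨S, hS⟩ := pr_sum gm₁ w
  refine ⟨∑ i ∈ S, y i, ?_⟩
  rw [map_sum]
  refine hS.trans ?_
  exact Finset.sum_congr rfl fun i _ => hy i

lemma qis_of (h1 : HasDeg gm₁ gm₁ D₁ 1) (h2 : HasDeg gm₂ gm₂ D₂ 1)
    (hf : ∀ j, ∀ m ∈ gm₁ j, f m ∈ gm₂ j) (hfD : ∀ m, f (D₁ m) = D₂ (f m))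
    (hs : ∀ z, D₂ z = 0 → ∃ w, D₁ w = 0 ∧ ∃ y, f w - z = D₂ y)
    (hi : ∀ w, D₁ w = 0 → ∀ y, f w = D₂ y → ∃ y', w = D₁ y') :
    QIsoData gm₁ D₁ gm₂ D₂ f := by
  have hf' : HasDeg gm₁ gm₂ f 0 := fun j m hm => by rw [add_zero]; exact hf j m hm
  refine ⟨fun n x hx => ⟨hf n x hx.1, ?_⟩, ?_, fun n => ⟨?_, ?_⟩⟩
  · have := hx.2
    simp only [SetLike.mem_coe, LinearMap.mem_ker] at this ⊢
    rw [← hfD, this, map_zero]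
  · rintro n x ⟨hx, y, hy⟩
    exact ⟨hf n x hx, f y, by rw [← hfD, hy]⟩
  · rintro z ⟨hz, hz'⟩
    obtain ⟨w, hw, y, hy⟩ := hs z hz'
    have h3 := hf'.comm n w
    rw [add_zero] at h3
    refine ⟨pr gm₁ n w, ⟨pr_mem _ _ _, ?_⟩, sub_mem (hf n _ (pr_mem _ _ _)) hz, pr gm₂ (n - 1) y, ?_⟩
    · have := h1.comm n w
      rw [hw, map_zero] at this
      exact this
    · have h4 := h2.comm (n - 1) y
      rw [sub_add_cancel] at h4
      rw [h4, ← hy, map_sub, ← h3, pr_same gm₂ hz]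
  · rintro w ⟨hw, hw'⟩ ⟨_, y, hy⟩
    obtain ⟨y', hy'⟩ := hi w hw' y hy.symm
    exact ⟨hw, y', hy'.symm⟩
end Q

def FinCoh {M : Type} [AddCommGroup M] [Module k M] (D : M →ₗ[k] M) : Prop :=
  ∃ W : Submodule k M, FiniteDimensional k W ∧ ∀ m, D m = 0 → m ∈ W ⊔ LinearMap.range D

lemma SDR.finCoh {M : Type} [AddCommGroup M] [Module k M] {gm : ℤ → Submodule k M}
    {D : M →ₗ[k] M} (s : SDR gm D) : FinCoh D := by
  refine ⟨Submodule.span k (Set.range s.h), FiniteDimensional.span_of_finite k (Set.finite_range _), ?_⟩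
  intro m hm
  have := s.proj m
  rw [hm, map_zero, sub_zero, sub_eq_iff_eq_add] at this
  rw [this]
  refine Submodule.add_mem_sup (sum_mem fun l _ => Submodule.smul_mem _ _ (Submodule.subset_span ⟨l, rfl⟩)) ⟨_, rfl⟩

lemma twisted_finCoh (hA : FinCoh A.d) (T : DGMod A) (hT : IsTwisted T) : FinCoh T.D := by
  obtain ⟨WA, hWA, hWA'⟩ := hA
  obtain ⟨s, r, e, he, hDe, hbij⟩ := hT
  let Θl : (Fin s → A.R) →ₗ[k] T.M := ∑ j, (T.act.flip (e j)) ∘ₗ LinearMap.proj j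
  have hΘl : ∀ v, Θl v = ∑ j, T.act (v j) (e j) := fun v => by simp [Θl]
  let Θ : (Fin s → A.R) ≃ₗ[k] T.M := LinearEquiv.ofBijective Θl (by
    convert hbij using 1
    ext v; exact hΘl v)
  have hΘ : ∀ v, Θ v = ∑ j, T.act (v j) (e j) := hΘl
  let cd : Fin s → T.M →ₗ[k] A.R := fun j => LinearMap.proj j ∘ₗ Θ.symm.toLinearMap
  have hcdΘ : ∀ v j, cd j (Θ v) = v j := fun v j => by simp [cd]
  have hsum : ∀ t, t = ∑ j, T.act (cd j t) (e j) := fun t => by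
    conv_lhs => rw [← Θ.apply_symm_apply t, hΘ]
    rfl
  have hcda : ∀ j a t, cd j (T.act a t) = cd j t * a := by
    intro j a t
    have : T.act a t = Θ (fun j => cd j t * a) := by
      rw [hΘ]
      conv_lhs => rw [hsum t, map_sum]
      exact Finset.sum_congr rfl fun i _ => (T.act_mul _ _ _).symm
    rw [this, hcdΘ]
  have hcde : ∀ i j a, cd i (T.act a (e j)) = if i = j then a else 0 := by
    intro i j a
    have : T.act a (e j) = Θ (Pi.single j a) := by
      rw [hΘ, Finset.sum_eq_single j]
      · simp
      · intro i _ hij; simp [Pi.single_eq_of_ne hij]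
      · simp
    rw [this, hcdΘ]
    by_cases h : i = j
    · subst h; simp
    · simp [h]
  let S : ℕ → Submodule k T.M := fun j => ⨅ i : Fin s, ⨅ _ : j ≤ i.val, LinearMap.ker (cd i)
  have hS : ∀ j t, t ∈ S j ↔ ∀ i : Fin s, j ≤ i.val → cd i t = 0 := by
    intro j t; simp [S, Submodule.mem_iInf]
  have hSact : ∀ j a t, t ∈ S j → T.act a t ∈ S j := by
    intro j a t ht
    rw [hS] at ht ⊢
    intro i hi
    rw [hcda, ht i hi, zero_mul]
  have hspan : ∀ j : Fin s, T.D (e j) ∈ S j := by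
    intro j
    have hle : rSpan T (e '' {i | i < j}) ≤ S j := by
      refine sInf_le ⟨?_, fun a m => hSact j a m⟩
      rintro _ ⟨i, hi, rfl⟩
      show e i ∈ S j
      rw [hS]
      intro l hl
      have := hcde l i 1
      rw [T.act_one] at this
      rw [this, if_neg]
      rintro rfl
      exact absurd hi (not_lt.2 hl)
    exact hle (hDe j)
  have hmono : ∀ i j, i ≤ j → S i ≤ S j := by
    intro i j hij t ht
    rw [hS] at ht ⊢
    exact fun l hl => ht l (hij.trans hl)
  have hDae : ∀ (j : Fin s) a, T.D (T.act a (e j)) - sgnk k (-(r j)) • T.act (A.d a) (e j) ∈ S j := by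
    intro j a
    rw [mod_leib, eps_mem T.gm (he j), map_smul, add_sub_cancel_right]
    exact hSact _ _ _ (hspan j)
  have claim : ∀ j, j ≤ s → ∃ W : Submodule k T.M, FiniteDimensional k W ∧
      ∀ m ∈ S j, T.D m = 0 → m ∈ W ⊔ LinearMap.range T.D := by
    intro j
    induction j with
    | zero =>
      intro _
      refine ⟨⊥, inferInstance, fun m hm _ => ?_⟩
      rw [hS] at hm
      rw [hsum m]
      simp [hm]
    | succ j ih =>
      intro hj
      obtain ⟨W, hW, hW'⟩ := ih (by omega)
      let J : Fin s := ⟨j, by omega⟩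
      let q := (LinearMap.range A.d).mkQ ∘ₗ cd J
      let E := LinearMap.ker T.D ⊓ S (j+1)
      -- top coefficient of a cycle is a cycle
      have htop : ∀ m ∈ S (j+1), m - T.act (cd J m) (e J) ∈ S j := by
        intro m hm
        rw [hS] at hm ⊢
        intro i hi
        rw [map_sub, hcde]
        split_ifs with h
        · rw [h, sub_self]
        · rw [hm i (by
            have : i.val ≠ j := fun h' => h (Fin.ext h')
            omega), sub_zero]
      have hDS : ∀ i, ∀ m ∈ S i, T.D m ∈ S i := by
        intro i m hm
        rw [hsum m, map_sum]
        refine sum_mem fun l _ => ?_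
        by_cases hl : i ≤ l.val
        · rw [(hS i m).1 hm l hl]; simp
        · have h1 := hmono l i (by omega) (hDae l (cd l m))
          have h2 : T.act (A.d (cd l m)) (e l) ∈ S i := by
            rw [hS]; intro i' hi'
            rw [hcde, if_neg]
            rintro rfl; exact hl hi'
          have := add_mem h1 (Submodule.smul_mem _ (sgnk k (-(r l))) h2)
          rwa [sub_add_cancel] at this
      have hcyc : ∀ m ∈ E, A.d (cd J m) = 0 := by
        rintro m ⟨hm, hm'⟩
        have h1 := hDS j _ (htop m hm')
        have h0 : T.D m = 0 := hm
        rw [map_sub, h0, zero_sub, neg_mem_iff] at h1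
        have h2 := sub_mem h1 (hDae J (cd J m))
        rw [sub_sub_cancel] at h2
        have := (hS _ _).1 h2 J le_rfl
        rw [map_smul, hcde, if_pos rfl] at this
        have h3 := congrArg (fun x => sgnk k (-(r J)) • x) this
        simpa [smul_smul, sgnk_sq] using h3
      let qE : E →ₗ[k] _ := q ∘ₗ E.subtype
      have hr : LinearMap.range qE ≤ WA.map (LinearMap.range A.d).mkQ := by
        rintro _ ⟨z, rfl⟩
        obtain ⟨w, hw, y, hy, hz⟩ := Submodule.mem_sup.1 (hWA' _ (hcyc z z.2))
        refine ⟨w, hw, ?_⟩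
        have h0 : (LinearMap.range A.d).mkQ y = 0 := (Submodule.Quotient.mk_eq_zero _).2 hy
        simp only [qE, q, LinearMap.comp_apply, Submodule.subtype_apply, ← hz, map_add, h0, add_zero]
      have hfd : FiniteDimensional k (LinearMap.range qE) := Submodule.finiteDimensional_of_le hr
      obtain ⟨g, hg⟩ := LinearMap.exists_rightInverse_of_surjective qE.rangeRestrict
        (LinearMap.range_eq_top.2 qE.surjective_rangeRestrict)
      let W' := LinearMap.range (E.subtype ∘ₗ g)
      refine ⟨W ⊔ W', inferInstance, fun m hm hm0 => ?_⟩
      have hmE : m ∈ E := ⟨hm0, hm⟩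
      let w' : E := g (qE.rangeRestrict ⟨m, hmE⟩)
      have hw' : (w' : T.M) ∈ W' := ⟨_, rfl⟩
      have hq : q m = q w' := by
        have := LinearMap.congr_fun hg (qE.rangeRestrict ⟨m, hmE⟩)
        exact (congrArg Subtype.val this).symm
      have hq' : cd J m - cd J w' ∈ LinearMap.range A.d := (Submodule.Quotient.eq _).1 hq
      obtain ⟨b, hb⟩ := hq'
      let y := sgnk k (-(r J)) • T.act b (e J)
      have hyS : (m - w') - T.D y ∈ S j := by
        have h1 := htop _ (sub_mem hm w'.2.2)
        have h2 := Submodule.smul_mem _ (sgnk k (-(r J))) (hDae J b)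
        rw [smul_sub, smul_smul, sgnk_sq, one_smul] at h2
        have h3 := sub_mem h1 h2
        rw [map_sub (cd J), ← hb] at h3
        simp only [y, map_smul]
        convert h3 using 1
        abel
      have hw0 : T.D (w' : T.M) = 0 := w'.2.1
      have h4 := hW' _ hyS (by rw [map_sub, map_sub, hm0, hw0, T.D_sq]; simp)
      have h5 : m = ((m - w') - T.D y) + w' + T.D y := by abel
      rw [h5]
      have hle : W ⊔ LinearMap.range T.D ≤ W ⊔ W' ⊔ LinearMap.range T.D :=
        sup_le_sup_right le_sup_left _
      exact add_mem (add_mem (hle h4) ((le_sup_right.trans le_sup_left : W' ≤ _) hw'))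
        ((le_sup_right : LinearMap.range T.D ≤ _) ⟨y, rfl⟩)
  obtain ⟨W, hW, hW'⟩ := claim s le_rfl
  refine ⟨W, hW, fun m hm => hW' m ?_ hm⟩
  rw [hS]
  intro i hi
  exact absurd i.2 (by omega)

lemma perfect_fin (hA : IsCompactAlg A) (N : DGMod A) (hN : IsPerfect N) : GrFin N.gm N.D := by
  obtain ⟨sA⟩ := exists_sdr A.gr A.d A.d_deg A.d_sq hA
  obtain ⟨T, P, hT, ⟨ι, ρ, h, h1, h2, h3⟩, F, hF⟩ := hN
  obtain ⟨W, hW, hW'⟩ := twisted_finCoh sA.finCoh T hT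
  refine GrFin.of_fin N.gm N.D N.D_deg N.D_sq (W.map (F.f ∘ₗ ρ.f)) inferInstance ?_
  intro z hz
  obtain ⟨w, hw, y, hy⟩ := qis_surj (gm₁ := P.gm) (gm₂ := N.gm) N.D_deg hF z hz
  obtain ⟨u, hu, _, ⟨v, rfl⟩, huv⟩ := Submodule.mem_sup.1 (hW' (ι.f w) (by rw [← ι.comm, hw, map_zero]))
  have h4 := h3 w
  rw [hw, map_zero, add_zero] at h4
  have h5 : ρ.f (ι.f w) - w = P.D (h w) := h4
  have h6 : z = F.f (ρ.f u) + N.D (F.f (ρ.f v) - F.f (h w) - y) := by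
    have e1 : w = ρ.f u + P.D (ρ.f v) - P.D (h w) := by
      rw [← h5, ← huv, map_add, ρ.comm]; abel
    have e2 : z = F.f w - N.D y := by rw [← hy]; abel
    have e3 := congrArg F.f e1
    simp only [map_sub, map_add, F.comm] at e3
    rw [e2, e3]
    simp only [map_sub]
    abel
  rw [h6]
  exact Submodule.add_mem_sup ⟨u, hu, rfl⟩ ⟨_, rfl⟩

end PIF

namespace PIF
section Ten
variable (N : DGMod A) (V : DGBimod A)

abbrev TQ : Type := (N.M ⊗[k] V.M) ⧸ tenRelMB N V

def tm : N.M →ₗ[k] V.M →ₗ[k] TQ N V := (TensorProduct.mk k N.M V.M).compr₂ (tenRelMB N V).mkQ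

variable {N V}
lemma tm_act (a : A.R) (n : N.M) (v : V.M) : tm N V (N.act a n) v = tm N V n (V.actL a v) := by
  refine (Submodule.Quotient.eq _).2 ?_
  exact Submodule.subset_span ⟨a, n, v, rfl⟩

variable {Q : Type} [AddCommGroup Q] [Module k Q]

def tlift (φ : N.M →ₗ[k] V.M →ₗ[k] Q) (h : ∀ a n v, φ (N.act a n) v = φ n (V.actL a v)) :
    TQ N V →ₗ[k] Q :=
  (tenRelMB N V).liftQ (TensorProduct.lift φ) (by
    rw [tenRelMB, Submodule.span_le]
    rintro _ ⟨a, n, v, rfl⟩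
    simp [h])

@[simp] lemma tlift_tm (φ : N.M →ₗ[k] V.M →ₗ[k] Q) (h) (n : N.M) (v : V.M) :
    tlift φ h (tm N V n v) = φ n v := by
  simp [tlift, tm]

lemma t_ext {f g : TQ N V →ₗ[k] Q} (h : ∀ n v, f (tm N V n v) = g (tm N V n v)) : f = g := by
  apply Submodule.linearMap_qext
  apply TensorProduct.ext'
  exact h

lemma t_span : Submodule.span k {x : TQ N V | ∃ (i j : ℤ) (n : N.M) (v : V.M),
    n ∈ N.gm i ∧ v ∈ V.gm j ∧ x = tm N V n v} = ⊤ := by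
  set S := Submodule.span k {x : TQ N V | ∃ (i j : ℤ) (n : N.M) (v : V.M),
    n ∈ N.gm i ∧ v ∈ V.gm j ∧ x = tm N V n v} with hS
  have : S.mkQ = 0 := by
    apply t_ext
    intro n v
    have h2 : (tm N V).compr₂ S.mkQ = 0 := by
      apply gr_ext₂ N.gm V.gm
      intro i n hn j v hv
      exact (Submodule.Quotient.mk_eq_zero _).2 (Submodule.subset_span ⟨i, j, n, v, hn, hv, rfl⟩)
    exact LinearMap.congr_fun₂ h2 n v
  rw [← Submodule.ker_mkQ S, this, LinearMap.ker_zero]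

variable (N V) in
def tgm (n : ℤ) : Submodule k (TQ N V) :=
  Submodule.span k {x | ∃ (i j : ℤ) (m : N.M) (v : V.M),
    m ∈ N.gm i ∧ v ∈ V.gm j ∧ i + j = n ∧ x = tm N V m v}

lemma tm_mem {i j n : ℤ} {m : N.M} {v : V.M} (hm : m ∈ N.gm i) (hv : v ∈ V.gm j) (h : i + j = n) :
    tm N V m v ∈ tgm N V n := Submodule.subset_span ⟨i, j, m, v, hm, hv, h, rfl⟩

lemma tgm_induct {n : ℤ} (G : TQ N V →ₗ[k] Q) (S : Submodule k Q)
    (h : ∀ i j, i + j = n → ∀ m ∈ N.gm i, ∀ v ∈ V.gm j, G (tm N V m v) ∈ S) (t : TQ N V)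
    (ht : t ∈ tgm N V n) : G t ∈ S := by
  have : tgm N V n ≤ S.comap G := by
    rw [tgm, Submodule.span_le]
    rintro _ ⟨i, j, m, v, hm, hv, hij, rfl⟩
    exact h i j hij m hm v hv
  exact this ht

lemma tgm_eq {n : ℤ} (G G' : TQ N V →ₗ[k] Q)
    (h : ∀ i j, i + j = n → ∀ m ∈ N.gm i, ∀ v ∈ V.gm j, G (tm N V m v) = G' (tm N V m v)) (t : TQ N V)
    (ht : t ∈ tgm N V n) : G t = G' t := by
  have := tgm_induct (G - G') ⊥ (fun i j hij m hm v hv => by simp [h i j hij m hm v hv]) t ht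
  rw [Submodule.mem_bot, LinearMap.sub_apply, sub_eq_zero] at this
  exact this

lemma bal_of_hom (φ : N.M →ₗ[k] V.M →ₗ[k] Q)
    (h : ∀ p i j, ∀ a ∈ A.gr p, ∀ n ∈ N.gm i, ∀ v ∈ V.gm j, φ (N.act a n) v = φ n (V.actL a v))
    (a : A.R) (n : N.M) (v : V.M) : φ (N.act a n) v = φ n (V.actL a v) := by
  revert n v
  refine gr_induct A.gr (p := fun a => ∀ n v, φ (N.act a n) v = φ n (V.actL a v)) ?_ ?_ ?_ a
  · intro n v; simp
  · intro a b ha hb n v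
    simp [ha n v, hb n v]
  · intro p a ha n v
    have : φ ∘ₗ N.act a = φ.compl₂ (V.actL a) :=
      gr_ext₂ N.gm V.gm fun i n hn j v hv => h p i j a ha n hn v hv
    exact LinearMap.congr_fun₂ this n v

variable (N V) in
def tpr (n : ℤ) : TQ N V →ₗ[k] TQ N V :=
  tlift (glue N.gm (fun i => (tm N V).compl₂ (pr V.gm (n - i)))) (by
    apply bal_of_hom
    intro p i j a ha x hx v hv
    rw [glue_mem N.gm _ (N.act_deg p i a x ha hx), glue_mem N.gm _ hx]
    simp only [LinearMap.compl₂_apply]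
    by_cases hj : j = n - (i + p)
    · rw [pr_same V.gm (by rw [← hj]; exact hv),
        pr_same V.gm (by rw [show n - i = p + j by omega]; exact V.actL_deg p j a v ha hv), tm_act]
    · rw [pr_ne V.gm hj hv, pr_ne V.gm (show p + j ≠ n - i by omega) (V.actL_deg p j a v ha hv)]
      simp)

lemma tpr_tm {i j : ℤ} {m : N.M} {v : V.M} (n : ℤ) (hm : m ∈ N.gm i) (hv : v ∈ V.gm j) :
    tpr N V n (tm N V m v) = if i + j = n then tm N V m v else 0 := by
  simp only [tpr, tlift_tm, glue_mem N.gm _ hm, LinearMap.compl₂_apply]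
  split_ifs with h
  · rw [pr_same V.gm (by rwa [← h, add_sub_cancel_left])]
  · rw [pr_ne V.gm (show j ≠ n - i by omega) hv, map_zero]

instance tdec : DirectSum.Decomposition (tgm N V) :=
  decompOfProj (tgm N V) (tpr N V)
    (fun n t ht => tgm_eq (tpr N V n) LinearMap.id (fun i j hij m hm v hv => by
      rw [tpr_tm n hm hv, if_pos hij]; rfl) t ht)
    (fun n n' hn t ht => tgm_eq (tpr N V n') 0 (fun i j hij m hm v hv => by
      rw [tpr_tm n' hm hv, if_neg (by rwa [hij])]; rfl) t ht)
    (by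
      rw [eq_top_iff, ← t_span, Submodule.span_le]
      rintro _ ⟨i, j, n, v, hn, hv, rfl⟩
      exact Submodule.mem_iSup_of_mem (i + j) (tm_mem hn hv rfl))

/-- functoriality -/
def tmap {W : DGBimod A} (f : V.M →ₗ[k] W.M) (hf : ∀ a v, f (V.actL a v) = W.actL a (f v)) :
    TQ N V →ₗ[k] TQ N W :=
  tlift ((tm N W).compl₂ f) (fun a n v => by simp [hf, tm_act])

@[simp] lemma tmap_tm {W : DGBimod A} (f : V.M →ₗ[k] W.M) (hf) (n : N.M) (v : V.M) :
    tmap f hf (tm N V n v) = tm N W n (f v) := by simp [tmap]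

/-- functoriality for odd maps -/
def tmapS {W : DGBimod A} (f : V.M →ₗ[k] W.M) (hf : ∀ a v, f (V.actL a v) = W.actL (ea A a) (f v)) :
    TQ N V →ₗ[k] TQ N W :=
  tlift ((tm N W).compl₁₂ (eps N.gm) f) (fun a n v => by simp [hf, tm_act, mod_eps])

@[simp] lemma tmapS_tm {W : DGBimod A} (f : V.M →ₗ[k] W.M) (hf) (n : N.M) (v : V.M) :
    tmapS f hf (tm N V n v) = tm N W (eps N.gm n) (f v) := by simp [tmapS]

variable (N V) in
def tD : TQ N V →ₗ[k] TQ N V :=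
  tlift ((tm N V).compl₁₂ N.D LinearMap.id + (tm N V).compl₁₂ (eps N.gm) V.D) (fun a n v => by
    simp [mod_leib, mod_eps, tm_act, bi_leibL, add_assoc])

@[simp] lemma tD_tm (n : N.M) (v : V.M) :
    tD N V (tm N V n v) = tm N V (N.D n) v + tm N V (eps N.gm n) (V.D v) := by simp [tD]

variable (N V) in
def tactA (a : A.R) : TQ N V →ₗ[k] TQ N V :=
  tlift ((tm N V).compl₂ (V.actR a)) (fun b n v => by simp [tm_act, V.actLR])

lemma tactA_tm (a : A.R) (n : N.M) (v : V.M) :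
    tactA N V a (tm N V n v) = tm N V n (V.actR a v) := tlift_tm _ _ _ _

variable (N V) in
def tact : A.R →ₗ[k] TQ N V →ₗ[k] TQ N V where
  toFun a := tactA N V a
  map_add' a b := t_ext fun n v => by
    rw [LinearMap.add_apply, tactA_tm, tactA_tm, tactA_tm, map_add, LinearMap.add_apply, map_add]
  map_smul' c a := t_ext fun n v => by
    rw [LinearMap.smul_apply, tactA_tm, tactA_tm, map_smul, LinearMap.smul_apply, map_smul]; rfl

@[simp] lemma tact_tm (a : A.R) (n : N.M) (v : V.M) :
    tact N V a (tm N V n v) = tm N V n (V.actR a v) := tactA_tm _ _ _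

variable (N V) in
def TM : DGMod A where
  M := TQ N V
  gm := tgm N V
  act := tact N V
  act_one := by
    have : tact N V 1 = LinearMap.id := t_ext fun n v => by simp [V.actR_one]
    exact fun m => LinearMap.congr_fun this m
  act_mul := by
    intro x y
    have : tact N V (x * y) = tact N V y ∘ₗ tact N V x := t_ext fun n v => by simp [V.actR_mul]
    exact fun m => LinearMap.congr_fun this m
  act_deg := by
    intro i j x m hx hm
    refine tgm_induct (tact N V x) _ ?_ m hm
    intro p q hpq n hn v hv
    rw [tact_tm]
    exact tm_mem hn (V.actR_deg _ _ _ _ hx hv) (by omega)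
  D := tD N V
  D_deg := by
    intro j m hm
    refine tgm_induct (tD N V) _ ?_ m hm
    intro p q hpq n hn v hv
    rw [tD_tm]
    exact add_mem (tm_mem (N.D_deg _ _ hn) hv (by omega))
      (tm_mem (eps_deg N.gm p n hn) (V.D_deg _ _ hv) (by omega))
  D_sq := by
    have : tD N V ∘ₗ tD N V = 0 := t_ext fun n v => by
      simp [N.D_sq, V.D_sq, mod_eps_D]
    exact fun m => LinearMap.congr_fun this m
  leibniz := by
    intro i j x m hx hm
    refine tgm_eq (tD N V ∘ₗ tact N V x) (tact N V x ∘ₗ tD N V + sgnz j • tact N V (A.d x)) ?_ m hm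
    intro p q hpq n hn v hv
    simp only [LinearMap.comp_apply, tact_tm, tD_tm, LinearMap.add_apply, LinearMap.smul_apply,
      map_add, bi_leibR, eps_mem V.gm hv, eps_mem N.gm hn, map_smul, sgnz_smul (k := k), ← hpq,
      sgnk_add, smul_smul]
    rw [mul_comm (sgnk k q) (sgnk k p)]
    abel

lemma t_span' (N : DGMod A) (V : DGBimod A) : Submodule.span k {x : (TM N V).M | ∃ (i j : ℤ) (n : N.M) (v : V.M),
    n ∈ N.gm i ∧ v ∈ V.gm j ∧ x = tm N V n v} = ⊤ := t_span

def TMmap {W : DGBimod A} (N : DGMod A) (F : BimodHom V W) : DGHom (TM N V) (TM N W) where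
  f := tmap F.f F.actLc
  deg := by
    intro j m hm
    refine tgm_induct (tmap F.f F.actLc) _ ?_ m hm
    intro p q hpq n hn v hv
    rw [tmap_tm]
    exact tm_mem hn (F.deg _ _ hv) hpq
  actc := by
    intro x
    have : tmap F.f F.actLc ∘ₗ tact N V x = tact N W x ∘ₗ tmap F.f F.actLc := t_ext fun n v => by
      simp [F.actRc]
    exact fun m => LinearMap.congr_fun this m
  comm := by
    have : tmap F.f F.actLc ∘ₗ tD N V = tD N W ∘ₗ tmap F.f F.actLc := t_ext fun n v => by
      simp [F.comm]
    exact fun m => LinearMap.congr_fun this m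

lemma tmapS_comm {W : DGBimod A} (f : V.M →ₗ[k] W.M) (hf) (g : V.M →ₗ[k] W.M) (hg)
    (h : ∀ v, g v = W.D (f v) + f (V.D v)) (t : TQ N V) :
    tmap g hg t = tD N W (tmapS f hf t) + tmapS f hf (tD N V t) := by
  have : tmap (N := N) g hg = tD N W ∘ₗ tmapS f hf + tmapS f hf ∘ₗ tD N V := t_ext fun n v => by
    simp only [tmap_tm, LinearMap.add_apply, LinearMap.comp_apply, tmapS_tm, tD_tm, map_add, h,
      mod_eps_D, map_neg, LinearMap.neg_apply, eps_eps]
    abel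
  exact LinearMap.congr_fun this t

lemma sgn_ea (V W : DGBimod A) (h : V.M →ₗ[k] W.M)
    (hh : ∀ (i : ℤ) (x : A.R), x ∈ A.gr i → ∀ m : V.M, h (V.actL x m) = sgnz i • W.actL x (h m))
    (a : A.R) (v : V.M) : h (V.actL a v) = W.actL (ea A a) (h v) := by
  have : V.actL.compr₂ h = W.actL.compl₁₂ (ea A) h := by
    apply gr_ext₂ A.gr V.gm
    intro i a ha j v hv
    simp [hh i a ha, ea, eps_mem A.gr ha, sgnz_smul (k := k)]
  exact LinearMap.congr_fun₂ this a v

lemma TM_summand (N : DGMod A) {P T : DGBimod A} (h : IsHoSummandB P T) :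
    IsHoSummand (TM N P) (TM N T) := by
  obtain ⟨ι, ρ, h, h1, h2, h3, h4⟩ := h
  have h2' := sgn_ea P P h h2
  refine ⟨TMmap N ι, TMmap N ρ, tmapS h h2', ?_, ?_, ?_⟩
  · intro j m hm
    refine tgm_induct (tmapS h h2') _ ?_ m hm
    intro p q hpq n hn v hv
    rw [tmapS_tm]
    exact tm_mem (eps_deg N.gm p n hn) (h1 _ _ hv) (by omega)
  · intro x
    have : tmapS h h2' ∘ₗ tact N P x = tact N P x ∘ₗ tmapS h h2' := t_ext fun n v => by
      simp [h3]
    exact fun m => LinearMap.congr_fun this m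
  · intro m
    refine Eq.trans ?_ (tmapS_comm h h2' (ρ.f ∘ₗ ι.f - LinearMap.id)
      (fun a v => by simp [ι.actLc, ρ.actLc]) (fun v => h4 v) m)
    have : (tmap ρ.f ρ.actLc ∘ₗ tmap ι.f ι.actLc - LinearMap.id : TQ N P →ₗ[k] TQ N P) =
      tmap (ρ.f ∘ₗ ι.f - LinearMap.id) (fun a v => by simp [ι.actLc, ρ.actLc]) :=
      t_ext fun n v => by simp
    exact LinearMap.congr_fun this m

def toA (F : BimodHom V (diagBimod A)) : V.M →ₗ[k] A.R := F.f

lemma toA_actL (F : BimodHom V (diagBimod A)) (a : A.R) (v : V.M) :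
    toA F (V.actL a v) = a * toA F v := F.actLc a v
lemma toA_actR (F : BimodHom V (diagBimod A)) (a : A.R) (v : V.M) :
    toA F (V.actR a v) = toA F v * a := F.actRc a v
lemma toA_D (F : BimodHom V (diagBimod A)) (v : V.M) :
    toA F (V.D v) = A.d (toA F v) := F.comm v
lemma toA_deg (F : BimodHom V (diagBimod A)) (j : ℤ) (v : V.M) (hv : v ∈ V.gm j) :
    toA F v ∈ A.gr j := F.deg j v hv

def tev (N : DGMod A) (F : BimodHom V (diagBimod A)) : TQ N V →ₗ[k] N.M :=
  tlift (N.act.flip.compl₂ (toA F)) (fun a n v => by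
    simp only [LinearMap.compl₂_apply, LinearMap.flip_apply]
    rw [toA_actL, N.act_mul])

lemma tev_tm (N : DGMod A) (F : BimodHom V (diagBimod A)) (n : N.M) (v : V.M) :
    tev N F (tm N V n v) = N.act (toA F v) n := tlift_tm _ _ _ _

def TMev (N : DGMod A) (F : BimodHom V (diagBimod A)) : DGHom (TM N V) N where
  f := tev N F
  deg := by
    intro j m hm
    refine tgm_induct (tev N F) _ ?_ m hm
    intro p q hpq n hn v hv
    rw [tev_tm]
    have := N.act_deg _ _ _ _ (toA_deg F _ _ hv) hn
    rw [hpq] at this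
    exact this
  actc := by
    intro x m
    refine LinearMap.congr_fun (f := tev N F ∘ₗ tact N V x) (g := N.act x ∘ₗ tev N F)
      (t_ext fun n v => ?_) m
    rw [LinearMap.comp_apply, LinearMap.comp_apply, tact_tm, tev_tm, tev_tm, toA_actR, N.act_mul]
  comm := by
    intro m
    refine LinearMap.congr_fun (f := tev N F ∘ₗ tD N V) (g := N.D ∘ₗ tev N F)
      (t_ext fun n v => ?_) m
    rw [LinearMap.comp_apply, LinearMap.comp_apply, tD_tm, map_add, tev_tm, tev_tm, tev_tm, toA_D,
      mod_leib]

end Ten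

lemma hoSummand_trans {P X T : DGMod A} (h1 : IsHoSummand P X) (h2 : IsHoSummand X T) :
    IsHoSummand P T := by
  obtain ⟨ι, ρ, h, ha, hb, hc⟩ := h1
  obtain ⟨ι', ρ', h', ha', hb', hc'⟩ := h2
  refine ⟨ι'.comp ι, ρ.comp ρ', h + ρ.f ∘ₗ h' ∘ₗ ι.f, ?_, ?_, ?_⟩
  · intro j m hm
    exact add_mem (ha j m hm) (ρ.deg _ _ (ha' _ _ (ι.deg _ _ hm)))
  · intro x m
    simp [hb, hb', ι.actc, ρ.actc]
  · intro m
    have e1 : ρ.f (ι.f m) - m = P.D (h m) + h (P.D m) := hc m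
    have e2 : ρ'.f (ι'.f (ι.f m)) - ι.f m = X.D (h' (ι.f m)) + h' (X.D (ι.f m)) := hc' (ι.f m)
    have e3 := congrArg ρ.f e2
    simp only [map_sub, map_add, ρ.comm] at e3
    show ρ.f (ρ'.f (ι'.f (ι.f m))) - m = P.D (h m + ρ.f (h' (ι.f m))) + (h (P.D m) + ρ.f (h' (ι.f (P.D m))))
    rw [map_add, ι.comm, ← sub_add_sub_cancel _ (ρ.f (ι.f m)) m, e1, e3]
    abel

end PIF

namespace PIF

def thB (T : DGBimod A) (e : T.M) : A.R ⊗[k] A.R →ₗ[k] T.M :=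
  TensorProduct.lift (T.actL.compl₂ (T.actR.flip e))

@[simp] lemma thB_tmul (T : DGBimod A) (e : T.M) (x y : A.R) :
    thB T e (x ⊗ₜ y) = T.actL x (T.actR y e) := by simp [thB]

/-- sign twist on the first factor -/
def sgT (A : DGAlgebra k) (r : ℤ) : A.R ⊗[k] A.R →ₗ[k] A.R ⊗[k] A.R :=
  TensorProduct.map (gop A.gr (fun i => sgnk k (i * r))) LinearMap.id

lemma sgT_sgT (r : ℤ) (w : A.R ⊗[k] A.R) : sgT A r (sgT A r w) = w := by
  have h1 : gop A.gr (fun i => sgnk k (i * r)) ∘ₗ gop A.gr (fun i => sgnk k (i * r)) =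
      LinearMap.id := by
    apply gr_ext A.gr
    intro i m hm
    simp [gop_mem A.gr _ hm, smul_smul, sgnk_sq]
  have : sgT A r ∘ₗ sgT A r = LinearMap.id := by
    rw [sgT, ← TensorProduct.map_comp, h1, LinearMap.id_comp, TensorProduct.map_id]
  exact LinearMap.congr_fun this w

lemma biact_tmul (T : DGBimod A) (e : T.M) {r : ℤ} (he : e ∈ T.gm r) (w : A.R ⊗[k] A.R) :
    biact T w e = thB T e (sgT A r w) := by
  have h : (biact T).flip e = thB T e ∘ₗ sgT A r := by
    apply TensorProduct.ext
    apply gr_ext A.gr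
    intro i x hx
    ext y
    show biact T (x ⊗ₜ y) e = thB T e (sgT A r (x ⊗ₜ y))
    simp only [LinearMap.comp_apply, sgT, TensorProduct.map_tmul, gop_mem A.gr _ hx, biact,
      TensorProduct.lift.tmul, LinearEquiv.coe_coe, decomposeLinearEquiv_apply,
      LinearMap.id_apply, thB_tmul, map_smul, LinearMap.smul_apply]
    rw [DirectSum.decompose_of_mem A.gr hx]
    erw [DirectSum.toModule_lof]
    simp only [biactAux, LinearMap.coe_mk, AddHom.coe_mk, LinearMap.comp_apply,
      gop_mem T.gm _ he, map_smul]
  exact LinearMap.congr_fun h w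

/-- coordinates on a twisted bimodule -/
structure TB (T : DGBimod A) where
  s : ℕ
  r : Fin s → ℤ
  e : Fin s → T.M
  e_mem : ∀ j, e j ∈ T.gm (r j)
  cd : Fin s → T.M →ₗ[k] A.R ⊗[k] A.R
  cd_th : ∀ i j w, cd i (thB T (e j) w) = if i = j then w else 0
  sum : ∀ t, ∑ j, thB T (e j) (cd j t) = t
  D_e : ∀ j i, j ≤ i → cd i (T.D (e j)) = 0

def mL (a : A.R) : A.R ⊗[k] A.R →ₗ[k] A.R ⊗[k] A.R :=
  TensorProduct.map (LinearMap.mulLeft k a) LinearMap.id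
def mR (a : A.R) : A.R ⊗[k] A.R →ₗ[k] A.R ⊗[k] A.R :=
  TensorProduct.map LinearMap.id (LinearMap.mulRight k a)

lemma thB_mL (T : DGBimod A) (e : T.M) (a : A.R) (w : A.R ⊗[k] A.R) :
    thB T e (mL a w) = T.actL a (thB T e w) := by
  have : thB T e ∘ₗ mL a = T.actL a ∘ₗ thB T e := TensorProduct.ext' fun x y => by
    simp [mL, T.actL_mul]
  exact LinearMap.congr_fun this w

lemma thB_mR (T : DGBimod A) (e : T.M) (a : A.R) (w : A.R ⊗[k] A.R) :
    thB T e (mR a w) = T.actR a (thB T e w) := by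
  have : thB T e ∘ₗ mR a = T.actR a ∘ₗ thB T e := TensorProduct.ext' fun x y => by
    simp [mR, T.actR_mul, T.actLR]
  exact LinearMap.congr_fun this w

section cdlin
variable {T : DGBimod A} {s : ℕ} {e : Fin s → T.M} {cd : Fin s → T.M →ₗ[k] A.R ⊗[k] A.R}
    (cd_th : ∀ i j w, cd i (thB T (e j) w) = if i = j then w else 0)
    (sum : ∀ t, ∑ j, thB T (e j) (cd j t) = t)

lemma cd_actL0 (cd_th : ∀ i j w, cd i (thB T (e j) w) = if i = j then w else 0)
    (sum : ∀ t, ∑ j, thB T (e j) (cd j t) = t) (i : Fin s) (a : A.R) (t : T.M) :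
    cd i (T.actL a t) = mL a (cd i t) := by
  conv_lhs => rw [← sum t]
  simp only [map_sum, ← thB_mL, cd_th]
  simp

lemma cd_actR0 (cd_th : ∀ i j w, cd i (thB T (e j) w) = if i = j then w else 0)
    (sum : ∀ t, ∑ j, thB T (e j) (cd j t) = t) (i : Fin s) (a : A.R) (t : T.M) :
    cd i (T.actR a t) = mR a (cd i t) := by
  conv_lhs => rw [← sum t]
  simp only [map_sum, ← thB_mR, cd_th]
  simp
end cdlin

lemma exists_TB (T : DGBimod A) (h : IsTwistedB T) : Nonempty (TB T) := by
  obtain ⟨s, r, e, he, hD, hb⟩ := h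
  let Φ : (Fin s → A.R ⊗[k] A.R) →ₗ[k] T.M := ∑ j, thB T (e j) ∘ₗ sgT A (-(r j)) ∘ₗ LinearMap.proj j
  have hΦ : ∀ v, Φ v = ∑ j, biact T (v j) (e j) := fun v => by
    simp only [Φ, LinearMap.sum_apply, LinearMap.comp_apply, LinearMap.proj_apply]
    exact Finset.sum_congr rfl fun j _ => (biact_tmul T (e j) (he j) (v j)).symm
  have hb' : Function.Bijective Φ := by
    have : (Φ : _ → T.M) = fun v => ∑ j, biact T (v j) (e j) := funext hΦ
    rw [this]; exact hb
  let E := LinearEquiv.ofBijective Φ hb'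
  let cd : Fin s → T.M →ₗ[k] A.R ⊗[k] A.R := fun j => sgT A (-(r j)) ∘ₗ LinearMap.proj j ∘ₗ E.symm.toLinearMap
  have cd_th : ∀ i j w, cd i (thB T (e j) w) = if i = j then w else 0 := by
    intro i j w
    have : thB T (e j) w = E (Pi.single j (sgT A (-(r j)) w)) := by
      show _ = Φ _
      simp only [Φ, LinearMap.sum_apply, LinearMap.comp_apply, LinearMap.proj_apply]
      rw [Finset.sum_eq_single j]
      · rw [Pi.single_eq_same, sgT_sgT]
      · intro b _ hb; rw [Pi.single_eq_of_ne hb, map_zero, map_zero]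
      · simp
    rw [this]
    simp only [cd, LinearMap.comp_apply, LinearEquiv.coe_coe, E.symm_apply_apply, LinearMap.proj_apply]
    split_ifs with h
    · subst h; rw [Pi.single_eq_same, sgT_sgT]
    · rw [Pi.single_eq_of_ne h, map_zero]
  have sum : ∀ t, ∑ j, thB T (e j) (cd j t) = t := by
    intro t
    have : Φ (E.symm t) = t := E.apply_symm_apply t
    conv_rhs => rw [← this]
    simp [Φ, cd]
  refine ⟨⟨s, fun j => -(r j), e, he, cd, cd_th, sum, ?_⟩⟩
  intro j i hij
  have hmem : T.D (e j) ∈ LinearMap.ker (cd i) := by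
    refine (Submodule.mem_sInf.1 (hD j)) _ ⟨?_, ?_, ?_⟩
    · rintro _ ⟨l, hl, rfl⟩
      have h1 : e l = thB T (e l) (1 ⊗ₜ 1) := by simp [T.actL_one, T.actR_one]
      rw [SetLike.mem_coe, LinearMap.mem_ker, h1, cd_th, if_neg (ne_of_gt (lt_of_lt_of_le hl hij))]
    · intro x m hm
      rw [LinearMap.mem_ker] at hm ⊢
      rw [cd_actL0 cd_th sum, hm, map_zero]
    · intro x m hm
      rw [LinearMap.mem_ker] at hm ⊢
      rw [cd_actR0 cd_th sum, hm, map_zero]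
  exact hmem

namespace TB
variable {T : DGBimod A} (B : TB T)

lemma cd_actL (i : Fin B.s) (a : A.R) (t : T.M) : B.cd i (T.actL a t) = mL a (B.cd i t) :=
  cd_actL0 B.cd_th B.sum i a t
lemma cd_actR (i : Fin B.s) (a : A.R) (t : T.M) : B.cd i (T.actR a t) = mR a (B.cd i t) :=
  cd_actR0 B.cd_th B.sum i a t

lemma cd_e (i j : Fin B.s) : B.cd i (B.e j) = if i = j then 1 ⊗ₜ 1 else 0 := by
  have h1 : B.e j = thB T (B.e j) (1 ⊗ₜ 1) := by simp [T.actL_one, T.actR_one]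
  rw [h1, B.cd_th]

def S (n : ℕ) : Submodule k T.M := ⨅ i : Fin B.s, ⨅ _ : n ≤ i.val, LinearMap.ker (B.cd i)

lemma mem_S {n : ℕ} {t : T.M} : t ∈ B.S n ↔ ∀ i : Fin B.s, n ≤ i.val → B.cd i t = 0 := by
  simp [S, Submodule.mem_iInf]

lemma S_actL {n : ℕ} {t : T.M} (ht : t ∈ B.S n) (a : A.R) : T.actL a t ∈ B.S n := by
  rw [mem_S] at *
  intro i hi; rw [cd_actL, ht i hi, map_zero]
lemma S_actR {n : ℕ} {t : T.M} (ht : t ∈ B.S n) (a : A.R) : T.actR a t ∈ B.S n := by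
  rw [mem_S] at *
  intro i hi; rw [cd_actR, ht i hi, map_zero]
lemma S_mono {n m : ℕ} (h : n ≤ m) : B.S n ≤ B.S m := by
  intro t ht
  rw [mem_S] at *
  exact fun i hi => ht i (h.trans hi)
lemma De_mem (j : Fin B.s) : T.D (B.e j) ∈ B.S j.val := by
  rw [mem_S]; exact fun i hi => B.D_e j i hi
lemma e_mem_S (j : Fin B.s) {n : ℕ} (hn : j.val < n) : B.e j ∈ B.S n := by
  rw [mem_S]; intro i hi
  rw [cd_e, if_neg]; rintro rfl; omega

/-- to check a property linear in t ∈ S n -/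
lemma S_induct {n : ℕ} {Q : Submodule k T.M}
    (h : ∀ j : Fin B.s, j.val < n → ∀ x y, T.actL x (T.actR y (B.e j)) ∈ Q) {t : T.M} (ht : t ∈ B.S n) :
    t ∈ Q := by
  rw [← B.sum t]
  refine Submodule.sum_mem _ fun j _ => ?_
  by_cases hj : j.val < n
  · have : ∀ w, thB T (B.e j) w ∈ Q := by
      intro w
      induction w with
      | zero => rw [map_zero]; exact Q.zero_mem
      | tmul x y => rw [thB_tmul]; exact h j hj x y
      | add a b ha hb => rw [map_add]; exact Q.add_mem ha hb
    exact this _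
  · rw [B.mem_S.1 ht j (by omega), map_zero]; exact Q.zero_mem

lemma D_gen (j : Fin B.s) (x y : A.R) : T.D (T.actL x (T.actR y (B.e j))) =
    T.actL (A.d x) (T.actR y (B.e j)) + T.actL (ea A x) (T.actR y (T.D (B.e j))) +
      sgnk k (B.r j) • T.actL (ea A x) (T.actR (A.d y) (B.e j)) := by
  rw [bi_leibL, bi_leibR, map_add, eps_mem T.gm (B.e_mem j), map_smul, map_smul, add_assoc]

lemma S_D {n : ℕ} {t : T.M} (ht : t ∈ B.S n) : T.D t ∈ B.S n := by
  refine B.S_induct (Q := (B.S n).comap T.D) ?_ ht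
  intro j hj x y
  rw [Submodule.mem_comap, D_gen]
  have h1 := B.e_mem_S j hj
  have h2 := B.S_mono hj.le (B.De_mem j)
  exact add_mem (add_mem (B.S_actL (B.S_actR h1 _) _) (B.S_actL (B.S_actR h2 _) _))
    (Submodule.smul_mem _ _ (B.S_actL (B.S_actR h1 _) _))

lemma S_top {t : T.M} {n : ℕ} (hn : B.s ≤ n) : t ∈ B.S n := by
  rw [mem_S]; intro i hi; have := i.2; omega
lemma S_zero {t : T.M} (h : t ∈ B.S 0) : t = 0 := by
  rw [← B.sum t]
  exact Finset.sum_eq_zero fun j _ => by rw [B.mem_S.1 h j (by omega), map_zero]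

lemma null (B : TB T) {C : Type} [AddCommGroup C] [Module k C] (lam : A.R →ₗ[k] C →ₗ[k] C)
    (lam_mul : ∀ a b m, lam (a * b) m = lam a (lam b m)) (lam_one : ∀ m, lam 1 m = m)
    (DC : C →ₗ[k] C) (leib : ∀ a m, DC (lam a m) = lam (A.d a) m + lam (ea A a) (DC m))
    (hD : ∀ m, DC (DC m) = 0)
    (c : C →ₗ[k] C) (hc : ∀ m, DC (c m) + c (DC m) = m)
    (f : T.M →ₗ[k] C) (hf : ∀ a t, f (T.actL a t) = lam a (f t)) (hfD : ∀ t, f (T.D t) = DC (f t)) :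
    ∃ H : T.M →ₗ[k] C, (∀ a t, H (T.actL a t) = lam (ea A a) (H t)) ∧
      ∀ t, f t = DC (H t) + H (T.D t) := by
  suffices key : ∀ m n, n + m = B.s → ∀ f : T.M →ₗ[k] C, (∀ a t, f (T.actL a t) = lam a (f t)) →
      (∀ t, f (T.D t) = DC (f t)) → (∀ t ∈ B.S n, f t = 0) → 
      ∃ H : T.M →ₗ[k] C, (∀ a t, H (T.actL a t) = lam (ea A a) (H t)) ∧
      ∀ t, f t = DC (H t) + H (T.D t) from
    key B.s 0 (by omega) f hf hfD (fun t ht => by rw [B.S_zero ht, map_zero])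
  intro m
  induction m with
  | zero =>
    intro n hn f hf hfD h0
    exact ⟨0, by simp, fun t => by simp [h0 t (B.S_top (by omega))]⟩
  | succ m ih =>
    intro n hn f hf hfD h0
    let j : Fin B.s := ⟨n, by omega⟩
    let G : A.R ⊗[k] A.R →ₗ[k] C :=
      TensorProduct.lift (lam.compl₁₂ (ea A) (c ∘ₗ f ∘ₗ T.actR.flip (B.e j)))
    have hG : ∀ x y, G (x ⊗ₜ y) = lam (ea A x) (c (f (T.actR y (B.e j)))) := fun x y => by simp [G]
    have hGL : ∀ a w, G (mL a w) = lam (ea A a) (G w) := by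
      intro a w
      have : G ∘ₗ mL a = lam (ea A a) ∘ₗ G := TensorProduct.ext' fun x y => by
        simp [mL, hG, ea_mul, lam_mul]
      exact LinearMap.congr_fun this w
    let H : T.M →ₗ[k] C := G ∘ₗ B.cd j
    have hHL : ∀ a t, H (T.actL a t) = lam (ea A a) (H t) := by
      intro a t
      simp only [H, LinearMap.comp_apply, B.cd_actL, hGL]
    have hHe : ∀ y, H (T.actR y (B.e j)) = c (f (T.actR y (B.e j))) := by
      intro y
      simp only [H, LinearMap.comp_apply, B.cd_actR, B.cd_e, if_true, mR, TensorProduct.map_tmul, hG]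
      simp [ea_one, lam_one]
    have hH0 : ∀ t ∈ B.S n, H t = 0 := by
      intro t ht
      simp only [H, LinearMap.comp_apply]
      rw [B.mem_S.1 ht j le_rfl, map_zero]
    let f' := f - DC ∘ₗ H - H ∘ₗ T.D
    have hf' : ∀ t, f' t = f t - DC (H t) - H (T.D t) := fun t => rfl
    have h1 : ∀ a t, f' (T.actL a t) = lam a (f' t) := by
      intro a t
      simp only [hf', hf, hHL, bi_leibL, leib, map_sub, map_add, ea_ea, ea_d, map_neg,
        LinearMap.neg_apply]
      abel
    obtain ⟨H', hL', hH'⟩ := ih (n + 1) (by omega) f' h1 (by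
        intro t
        simp only [hf', hfD, map_sub, T.D_sq, map_zero, hD]
        abel) (by
        intro t ht
        refine (B.S_induct (Q := LinearMap.ker f') ?_ ht)
        intro i hi x y
        rw [LinearMap.mem_ker, h1]
        suffices f' (T.actR y (B.e i)) = 0 by rw [this, map_zero]
        rw [hf']
        by_cases hin : i.val < n
        · have hm := B.S_actR (B.e_mem_S i hin) y
          rw [h0 _ hm, hH0 _ hm, hH0 _ (B.S_D hm)]; simp
        · have hij : i = j := Fin.ext (by show i.val = n; omega)
          rw [hij]
          have hm := B.S_actR (B.De_mem j) y
          have e1 : H (T.D (T.actR y (B.e j))) = c (f (T.D (T.actR y (B.e j)))) := by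
            rw [bi_leibR, map_add, map_add, h0 _ hm, hH0 _ hm, zero_add, zero_add,
              eps_mem T.gm (B.e_mem j), map_smul, map_smul, hHe, map_smul, map_smul]
          rw [e1, hHe, hfD]
          have := hc (f (T.actR y (B.e j)))
          conv_lhs => enter [1, 1]; rw [← this]
          abel)
    refine ⟨H + H', fun a t => by simp [hHL, hL'], fun t => ?_⟩
    have := hH' t
    rw [hf'] at this
    simp only [LinearMap.add_apply, map_add]
    rw [sub_sub, sub_eq_iff_eq_add] at this
    rw [this]; abel
end TB
end PIF

namespace PIF

lemma exists_splitting {P T : DGBimod A} (B : TB T) (ρ : BimodHom T P) (F : BimodHom P (diagBimod A))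
    (hF : QIsoData P.gm P.D (diagBimod A).gm (diagBimod A).D F.f) :
    ∃ (p0 : P.M) (b : A.R) (H : T.M →ₗ[k] P.M), P.D p0 = 0 ∧ toA F p0 - 1 = A.d b ∧
      (∀ a t, H (T.actL a t) = P.actL (ea A a) (H t)) ∧
      ∀ t, P.actL (toA F (ρ.f t)) p0 - ρ.f t = P.D (H t) + H (T.D t) := by
  have hs : ∀ z : A.R, A.d z = 0 → ∃ w, P.D w = 0 ∧ ∃ y, toA F w - z = A.d y :=
    fun z hz => qis_surj (gm₁ := P.gm) (gm₂ := A.gr) A.d_deg hF z hz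
  have hi : ∀ w, P.D w = 0 → ∀ y, toA F w = A.d y → ∃ y', w = P.D y' :=
    fun w hw y hy => qis_inj (gm₁ := P.gm) (gm₂ := A.gr) P.D_deg A.d_deg F.deg hF w hw y hy
  obtain ⟨p0, hp0, b, hb⟩ := hs 1 d_one
  let DC : (P.M × A.R) →ₗ[k] (P.M × A.R) :=
    LinearMap.prod (P.D ∘ₗ LinearMap.fst k _ _)
      (toA F ∘ₗ LinearMap.fst k _ _ - A.d ∘ₗ LinearMap.snd k _ _)
  have hDC : ∀ p b, DC (p, b) = (P.D p, toA F p - A.d b) := fun p b => rfl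
  let lam : A.R →ₗ[k] (P.M × A.R) →ₗ[k] (P.M × A.R) := LinearMap.mk₂ k
    (fun a x => (P.actL a x.1, ea A a * x.2))
    (by intros; simp [add_mul]) (by intros; simp) (by intros; simp [mul_add]) (by intros; simp)
  have hlam : ∀ a p b, lam a (p, b) = (P.actL a p, ea A a * b) := fun a p b => rfl
  have hDC2 : ∀ m, DC (DC m) = 0 := by
    rintro ⟨p, b⟩
    rw [hDC, hDC, P.D_sq, toA_D, map_sub, A.d_sq, sub_zero, sub_self]; rfl
  obtain ⟨c, hc⟩ := exists_contraction DC hDC2 (by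
    rintro ⟨p, b⟩ h
    rw [hDC, Prod.mk_eq_zero, sub_eq_zero] at h
    obtain ⟨p', hp'⟩ := hi p h.1 b h.2
    obtain ⟨w, hw, y, hy⟩ := hs (b - toA F p') (by rw [map_sub, ← h.2, hp', toA_D, sub_self])
    refine ⟨(p' + w, y), ?_⟩
    rw [hDC, map_add, map_add, hw, ← hy, ← hp', add_zero]
    congr 1
    abel)
  let g : T.M →ₗ[k] P.M := P.actL.flip p0 ∘ₗ toA F ∘ₗ ρ.f - ρ.f
  let h : T.M →ₗ[k] A.R := LinearMap.mulRight k b ∘ₗ ea A ∘ₗ toA F ∘ₗ ρ.f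
  have hg : ∀ t, g t = P.actL (toA F (ρ.f t)) p0 - ρ.f t := fun t => rfl
  have hh : ∀ t, h t = ea A (toA F (ρ.f t)) * b := fun t => rfl
  obtain ⟨H, hH1, hH2⟩ := B.null lam
    (by rintro a b ⟨p, c⟩; simp only [hlam, P.actL_mul, ea_mul, mul_assoc])
    (by rintro ⟨p, c⟩; simp only [hlam, P.actL_one, ea_one, one_mul]) DC
    (by
      rintro a ⟨p, c⟩
      simp only [hlam, hDC, bi_leibL, toA_actL, d_mul, d_ea, ea_ea, Prod.mk_add_mk, mul_sub,
        map_neg, neg_neg]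
      congr 1
      simp only [neg_mul]
      abel)
    hDC2 c hc (LinearMap.prod g h)
    (by
      intro a t
      show (g _, h _) = lam a (g t, h t)
      simp only [hlam, hg, hh, ρ.actLc, toA_actL, P.actL_mul, map_sub, ea_mul, mul_assoc])
    (by
      intro t
      show (g _, h _) = DC (g t, h t)
      simp only [hDC, hg, hh, ρ.comm, toA_D, map_sub, toA_actL, bi_leibL, hp0, map_zero, add_zero,
        d_mul, d_ea, ea_ea]
      congr 1
      rw [← hb]
      simp only [mul_sub, mul_one, neg_mul]
      abel)
  refine ⟨p0, b, LinearMap.fst k _ _ ∘ₗ H, hp0, hb, ?_, ?_⟩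
  · intro a t
    have := congrArg Prod.fst (hH1 a t)
    exact this
  · intro t
    have := congrArg Prod.fst (hH2 t)
    exact this

lemma TMev_qis (N : DGMod A) {P T : DGBimod A} (hT : IsTwistedB T) (hPT : IsHoSummandB P T)
    (F : BimodHom P (diagBimod A))
    (hF : QIsoData P.gm P.D (diagBimod A).gm (diagBimod A).D F.f) : IsQuasiIso (TMev N F) := by
  obtain ⟨B⟩ := exists_TB T hT
  obtain ⟨ι, ρ, h, h1, h2, h3, h4⟩ := hPT
  obtain ⟨p0, b, H, hp0, hb, hH1, hH2⟩ := exists_splitting B ρ F hF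
  refine qis_of (gm₁ := (TM N P).gm) (gm₂ := N.gm) (TM N P).D_deg N.D_deg (TMev N F).deg
    (TMev N F).comm ?_ ?_
  · intro n hn
    refine ⟨tm N P n p0, ?_, N.act b (eps N.gm n), ?_⟩
    · show tD N P _ = 0
      rw [tD_tm, hn, hp0]; simp
    · show tev N F _ - n = _
      have hd : N.D (eps N.gm n) = 0 := by
        have := mod_eps_D N n
        rw [hn, map_zero] at this
        exact neg_eq_zero.1 this.symm
      rw [tev_tm, mod_leib, hd, map_zero, zero_add, eps_eps, ← hb, map_sub, LinearMap.sub_apply,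
        N.act_one]
  · intro (z : TQ N P) hz y hy
    have hz' : tD N P z = 0 := hz
    have hy' : tev N F z = N.D y := hy
    have h2' := sgn_ea P P h h2
    let g : T.M →ₗ[k] P.M := P.actL.flip p0 ∘ₗ toA F ∘ₗ ρ.f - ρ.f
    have hg : ∀ t, g t = P.actL (toA F (ρ.f t)) p0 - ρ.f t := fun t => rfl
    have hgL : ∀ a t, g (T.actL a t) = P.actL a (g t) := by
      intro a t
      simp only [hg, ρ.actLc, toA_actL, P.actL_mul, map_sub]
    let w : TQ N T := tmap ι.f ι.actLc z
    have hw : tD N T w = 0 := by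
      have := (TMmap N ι).comm z
      have e : tmap ι.f ι.actLc (tD N P z) = tD N T w := this
      rw [← e, hz', map_zero]
    have e1 : tmap ρ.f ρ.actLc w - z = tD N P (tmapS h h2' z) := by
      have a1 := tmapS_comm (N := N) h h2' (ρ.f ∘ₗ ι.f - LinearMap.id)
        (fun a v => by simp [ι.actLc, ρ.actLc]) (fun v => h4 v) z
      have : (tmap ρ.f ρ.actLc ∘ₗ tmap ι.f ι.actLc - LinearMap.id : TQ N P →ₗ[k] TQ N P) =
        tmap (ρ.f ∘ₗ ι.f - LinearMap.id) (fun a v => by simp [ι.actLc, ρ.actLc]) :=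
        t_ext fun n v => by simp
      have a2 := LinearMap.congr_fun this z
      rw [a1, hz', map_zero, add_zero] at a2
      exact a2
    have e2 : tmap g hgL w = tD N P (tmapS H hH1 w) := by
      have := tmapS_comm (N := N) H hH1 g hgL (fun t => hH2 t) w
      rw [hw, map_zero, add_zero] at this
      exact this
    have e3 : tmap g hgL w = tm N P (tev N F (tmap ρ.f ρ.actLc w)) p0 - tmap ρ.f ρ.actLc w := by
      have : tmap g hgL = (tm N P).flip p0 ∘ₗ tev N F ∘ₗ tmap ρ.f ρ.actLc - tmap ρ.f ρ.actLc :=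
        t_ext fun n v => by
          simp only [tmap_tm, LinearMap.sub_apply, LinearMap.comp_apply, LinearMap.flip_apply, hg,
            map_sub, tev_tm, tm_act]
      exact LinearMap.congr_fun this w
    set u := tmapS h h2' z with hu
    have e4 : tmap ρ.f ρ.actLc w = z + tD N P u := by rw [← e1]; abel
    have e5 : tev N F (tD N P u) = N.D (tev N F u) := (TMev N F).comm u
    refine ⟨(tm N P (y + tev N F u) p0 - tmapS H hH1 w - u : TQ N P), ?_⟩
    show z = tD N P _
    rw [map_sub, map_sub, tD_tm, hp0, map_zero, add_zero, ← e2, e3, e4, map_add (tev N F), hy', e5,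
      map_add N.D]
    abel
end PIF

namespace PIF
section Ring
variable {E : Type} [Ring E]

def hC (s : ℕ) (c δ : E) : E := c * ∑ n ∈ Finset.range s, (-(δ * c)) ^ n

lemma hC_aux (c δ : E) (n : ℕ) : c * (-(δ * c)) ^ n = (-(c * δ)) ^ n * c := by
  induction n with
  | zero => simp
  | succ n ih => rw [pow_succ, ← mul_assoc, ih, pow_succ, mul_assoc, mul_assoc]; simp [mul_assoc]

lemma hC_eq (s : ℕ) (c δ : E) : hC s c δ = (∑ n ∈ Finset.range s, (-(c * δ)) ^ n) * c := by
  rw [hC, Finset.mul_sum, Finset.sum_mul]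
  exact Finset.sum_congr rfl fun n _ => hC_aux c δ n

lemma hC_sq (s : ℕ) {c δ : E} (cc : c * c = 0) : hC s c δ * hC s c δ = 0 := by
  conv_lhs => enter [1]; rw [hC_eq]
  rw [hC, mul_assoc, ← mul_assoc c c, cc, zero_mul, mul_zero]

lemma hC_D (s : ℕ) {c δ D : E} (hn : (δ * c) ^ s = 0) (cdc : c * (D - δ) * c = c) :
    hC s c δ * D * hC s c δ = hC s c δ := by
  have h1 : (1 + δ * c) * ∑ n ∈ Finset.range s, (-(δ * c)) ^ n = 1 := by
    have := mul_neg_geom_sum (-(δ * c)) s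
    rw [neg_pow, hn, mul_zero, sub_zero, sub_neg_eq_add] at this
    exact this
  have h2 : c * D * c = c * (1 + δ * c) := by
    have : c * D * c = c * (D - δ) * c + c * δ * c := by noncomm_ring
    rw [this, cdc]; noncomm_ring
  conv_lhs => enter [1, 1]; rw [hC_eq]
  rw [hC]
  set W := ∑ n ∈ Finset.range s, (-(δ * c)) ^ n
  set W' := ∑ n ∈ Finset.range s, (-(c * δ)) ^ n
  calc W' * c * D * (c * W) = W' * (c * D * c) * W := by noncomm_ring
    _ = W' * c * ((1 + δ * c) * W) := by rw [h2]; noncomm_ring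
    _ = W' * c := by rw [h1, mul_one]
    _ = c * W := by rw [← hC_eq, hC]

lemma pi_idem {D C : E} (DD : D * D = 0) (CC : C * C = 0) (CDC : C * D * C = C) :
    (1 - D * C - C * D) * (1 - D * C - C * D) = 1 - D * C - C * D := by
  have e1 : D * C * (D * C) = D * C := by rw [mul_assoc, ← mul_assoc C, CDC]
  have e2 : C * D * (C * D) = C * D := by rw [← mul_assoc, CDC]
  have e3 : D * C * (C * D) = 0 := by rw [mul_assoc, ← mul_assoc C, CC, zero_mul, mul_zero]
  have e4 : C * D * (D * C) = 0 := by rw [mul_assoc, ← mul_assoc D, DD, zero_mul, mul_zero]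
  have : (1 - D * C - C * D) * (1 - D * C - C * D) = 1 - D * C - C * D - D * C - C * D +
    D * C * (D * C) + C * D * (C * D) + D * C * (C * D) + C * D * (D * C) := by noncomm_ring
  rw [this, e1, e2, e3, e4]; abel

lemma pi_comm {D C : E} (DD : D * D = 0) : (1 - D * C - C * D) * D = D * (1 - D * C - C * D) := by
  have e1 : (1 - D * C - C * D) * D = D - D * C * D - C * (D * D) := by noncomm_ring
  have e2 : D * (1 - D * C - C * D) = D - D * D * C - D * C * D := by noncomm_ring
  rw [e1, e2, DD]; simp
end Ring

section Filt
variable {M : Type} [AddCommGroup M] [Module k M] (F : ℕ → Submodule k M)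

def Pres : Subring (Module.End k M) where
  carrier := {G | ∀ n, ∀ x ∈ F n, G x ∈ F n}
  mul_mem' := fun {G G'} h h' n x hx => h n _ (h' n x hx)
  one_mem' := fun n x hx => hx
  add_mem' := fun {G G'} h h' n x hx => add_mem (h n x hx) (h' n x hx)
  zero_mem' := fun n x hx => zero_mem _
  neg_mem' := fun {G} h n x hx => neg_mem (h n x hx)

def Low : AddSubgroup (Module.End k M) where
  carrier := {G | ∀ n, ∀ x ∈ F (n + 1), G x ∈ F n}
  add_mem' := fun {G G'} h h' n x hx => add_mem (h n x hx) (h' n x hx)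
  zero_mem' := fun n x hx => zero_mem _
  neg_mem' := fun {G} h n x hx => neg_mem (h n x hx)

variable {F}
lemma Low.mul_pres {G G' : Module.End k M} (h : G ∈ Low F) (h' : G' ∈ Pres F) : G * G' ∈ Low F :=
  fun n x hx => h n _ (h' (n + 1) x hx)
lemma Low.pres_mul {G G' : Module.End k M} (h : G ∈ Pres F) (h' : G' ∈ Low F) : G * G' ∈ Low F :=
  fun n x hx => h n _ (h' n x hx)
lemma Low.pres (hF : ∀ n, F n ≤ F (n + 1)) {G : Module.End k M} (h : G ∈ Low F) : G ∈ Pres F :=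
  fun n x hx => h n x (hF n hx)
lemma Low.nil (F0 : F 0 = ⊥) {s : ℕ} (Fs : F s = ⊤) {G : Module.End k M} (h : G ∈ Low F) : G ^ s = 0 := by
  have : ∀ m n, n + m = s → ∀ x, (G ^ m) x ∈ F n := by
    intro m
    induction m with
    | zero => intro n hn x; rw [show n = s by omega, Fs]; trivial
    | succ m ih =>
      intro n hn x
      rw [pow_succ', Module.End.mul_apply]
      exact h n _ (ih (n + 1) (by omega) x)
  ext x
  have := this s 0 (by omega) x
  rw [F0, Submodule.mem_bot] at this
  rw [this]; rfl

/-- unipotent conjugation of close idempotents -/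
lemma exists_psi (hF : ∀ n, F n ≤ F (n + 1)) (F0 : F 0 = ⊥) {s : ℕ} (Fs : F s = ⊤)
    {π π0 : Module.End k M} (hπ : π * π = π) (hπ0 : π0 * π0 = π0) (h0 : π0 ∈ Pres F)
    (hν : π - π0 ∈ Low F) :
    ∃ ψ ψ' : Module.End k M, ψ' ∈ Pres F ∧ ψ * ψ' = 1 ∧ ψ' * ψ = 1 ∧ ψ * π0 = π * π0 ∧
      π * ψ = π * π0 := by
  set y := (π - π0) * (1 - 2 * π0) with hy
  have hyL : y ∈ Low F := Low.mul_pres hν (by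
    refine sub_mem (one_mem _) ?_
    rw [two_mul]; exact add_mem h0 h0)
  have hyn := Low.nil F0 Fs hyL
  refine ⟨1 - y, ∑ n ∈ Finset.range s, y ^ n, ?_, ?_, ?_, ?_, ?_⟩
  · exact sum_mem fun n _ => pow_mem (Low.pres hF hyL) n
  · rw [mul_neg_geom_sum, hyn, sub_zero]
  · rw [geom_sum_mul_neg, hyn, sub_zero]
  · have : (1 - y) * π0 = π0 - π * π0 + π0 * π0 + 2 * (π * (π0 * π0)) - 2 * (π0 * π0 * π0) := by
      rw [hy]; noncomm_ring
    rw [this, hπ0, hπ0]; noncomm_ring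
  · have : π * (1 - y) = π - π * π + π * π0 + 2 * (π * π * π0) - 2 * (π * (π0 * π0)) := by
      rw [hy]; noncomm_ring
    rw [this, hπ, hπ0]; noncomm_ring

lemma hC_low {s : ℕ} {c δ : Module.End k M} (hF : ∀ n, F n ≤ F (n + 1)) (hc : c ∈ Pres F)
    (hδ : δ ∈ Low F) : hC s c δ ∈ Pres F ∧ (0 < s → hC s c δ - c ∈ Low F) := by
  have hW : ∀ n, (-(δ * c)) ^ n ∈ Pres F :=
    fun n => pow_mem (neg_mem (Low.pres hF (Low.mul_pres hδ hc))) n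
  refine ⟨mul_mem hc (sum_mem fun n _ => hW n), fun hs => ?_⟩
  obtain ⟨t, rfl⟩ : ∃ t, s = t + 1 := ⟨s - 1, by omega⟩
  have : hC (t + 1) c δ - c = c * ∑ n ∈ Finset.range t, (-(δ * c)) * (-(δ * c)) ^ n := by
    rw [hC, Finset.sum_range_succ', mul_add, pow_zero, mul_one, add_sub_cancel_right]
    congr 1
    exact Finset.sum_congr rfl fun n _ => pow_succ' _ _
  rw [this]
  refine Low.pres_mul hc (sum_mem fun n _ => Low.mul_pres (neg_mem (Low.mul_pres hδ hc)) (hW n))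

lemma hC_nu {s : ℕ} (hs : 0 < s) {c δ D : Module.End k M} (hF : ∀ n, F n ≤ F (n + 1)) (hc : c ∈ Pres F)
    (hδ : δ ∈ Low F) (hD : D ∈ Pres F) :
    (1 - D * hC s c δ - hC s c δ * D) - (1 - (D - δ) * c - c * (D - δ)) ∈ Low F := by
  obtain ⟨h1, h2⟩ := hC_low (s := s) hF hc hδ
  have e : (1 - D * hC s c δ - hC s c δ * D) - (1 - (D - δ) * c - c * (D - δ)) =
    -(D * (hC s c δ - c)) - δ * c - (hC s c δ - c) * D - c * δ := by noncomm_ring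
  rw [e]
  exact sub_mem (sub_mem (sub_mem (neg_mem (Low.pres_mul hD (h2 hs))) (Low.mul_pres hδ hc))
    (Low.mul_pres (h2 hs) hD)) (Low.pres_mul hc hδ)
end Filt

section Deg
variable {M : Type} [AddCommGroup M] [Module k M] {gm : ℤ → Submodule k M}
lemma deg_mul {G G' : Module.End k M} {e e' f : ℤ} (h : HasDeg gm gm G e) (h' : HasDeg gm gm G' e')
    (hf : e + e' = f) : HasDeg gm gm (G * G') f := by
  intro j m hm
  have := h _ _ (h' j m hm)
  rw [show j + e' + e = j + f by omega] at this
  exact this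
lemma deg_neg {G : Module.End k M} {e : ℤ} (h : HasDeg gm gm G e) : HasDeg gm gm (-G) e :=
  fun j m hm => neg_mem (h j m hm)
lemma deg_sub {G G' : Module.End k M} {e : ℤ} (h : HasDeg gm gm G e) (h' : HasDeg gm gm G' e) :
    HasDeg gm gm (G - G') e :=
  fun j m hm => sub_mem (h j m hm) (h' j m hm)
lemma deg_one : HasDeg gm gm (1 : Module.End k M) 0 := fun j m hm => by rw [add_zero]; exact hm
lemma deg_pow {G : Module.End k M} (h : HasDeg gm gm G 0) (n : ℕ) : HasDeg gm gm (G ^ n) 0 := by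
  induction n with
  | zero => exact deg_one
  | succ n ih => rw [pow_succ]; exact deg_mul ih h (by omega)
lemma deg_sum {ι : Type} (S : Finset ι) {G : ι → Module.End k M} {e : ℤ} (h : ∀ i ∈ S, HasDeg gm gm (G i) e) :
    HasDeg gm gm (∑ i ∈ S, G i) e := by
  intro j m hm
  rw [LinearMap.sum_apply]
  exact sum_mem fun i hi => h i hi j m hm
lemma hC_deg (s : ℕ) {c δ : Module.End k M} (hc : HasDeg gm gm c (-1)) (hδ : HasDeg gm gm δ 1) :
    HasDeg gm gm (hC s c δ) (-1) :=
  deg_mul hc (deg_sum _ fun n _ => deg_pow (deg_neg (deg_mul hδ hc (by omega))) n) (by omega)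
end Deg

/-- A-linear endomorphisms -/
def Lin (X : DGMod A) : Subring (Module.End k X.M) where
  carrier := {G | ∀ a x, G (X.act a x) = X.act a (G x)}
  mul_mem' := fun {G G'} h h' a x => by
    rw [Module.End.mul_apply, h', h]; rfl
  one_mem' := fun a x => rfl
  add_mem' := fun {G G'} h h' a x => by
    rw [LinearMap.add_apply, h, h', LinearMap.add_apply, map_add]
  zero_mem' := fun a x => by simp
  neg_mem' := fun {G} h a x => by rw [LinearMap.neg_apply, h, LinearMap.neg_apply, map_neg]

lemma hC_lin (X : DGMod A) (s : ℕ) {c δ : Module.End k X.M} (hc : c ∈ Lin X) (hδ : δ ∈ Lin X) :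
    hC s c δ ∈ Lin X :=
  mul_mem hc (sum_mem fun n _ => pow_mem (neg_mem (mul_mem hδ hc)) n)

/-- 1 - DC - CD is A-linear when C is, of degree -1 -/
lemma pi_lin (X : DGMod A) {C : Module.End k X.M} (hC : C ∈ Lin X) (hd : HasDeg X.gm X.gm C (-1)) :
    1 - X.D * C - C * X.D ∈ Lin X := by
  intro a x
  have h : ∀ a x, C (X.act a x) = X.act a (C x) := hC
  simp only [LinearMap.sub_apply, Module.End.mul_apply, Module.End.one_apply, h, mod_leib, map_add,
    map_sub, eps_anti' (gm := X.gm) hd, map_neg]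
  abel

section Split
variable (X : DGMod A) (π : Module.End k X.M)

lemma mem_rg {M : Type} [AddCommGroup M] [Module k M] {π : Module.End k M} (idem : π * π = π) {x : M} :
    x ∈ LinearMap.range π ↔ π x = x := by
  constructor
  · rintro ⟨y, rfl⟩; exact LinearMap.congr_fun idem y
  · intro h; exact ⟨x, h⟩

variable (deg : HasDeg X.gm X.gm π 0) (lin : π ∈ Lin X) (comm : π * X.D = X.D * π)

def splitDec (deg : HasDeg X.gm X.gm π 0) :
    DirectSum.Decomposition (fun j => (X.gm j).comap (LinearMap.range π).subtype) :=
  decompOfProj _ (fun n => (pr X.gm n).restrict (p := LinearMap.range π) (q := LinearMap.range π) (by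
      rintro _ ⟨y, rfl⟩
      have := deg.comm n y
      rw [add_zero] at this
      exact ⟨_, this⟩))
    (fun i m hm => Subtype.ext (pr_same X.gm hm))
    (fun i j hij m hm => Subtype.ext (pr_ne X.gm hij hm))
    (by
      rw [eq_top_iff]
      rintro ⟨m, hm⟩ -
      obtain ⟨S, hS⟩ := pr_sum X.gm m
      have hr : ∀ n, pr X.gm n m ∈ LinearMap.range π := by
        obtain ⟨y, rfl⟩ := hm
        intro n
        have := deg.comm n y
        rw [add_zero] at this
        exact ⟨_, this⟩
      have : (⟨m, hm⟩ : LinearMap.range π) = ∑ n ∈ S, ⟨pr X.gm n m, hr n⟩ := by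
        apply Subtype.ext
        rw [AddSubmonoidClass.coe_finset_sum]
        exact hS
      rw [this]
      exact sum_mem fun n _ => Submodule.mem_iSup_of_mem n (pr_mem X.gm n m))

def splitMod : DGMod A where
  M := LinearMap.range π
  gm := fun j => (X.gm j).comap (LinearMap.range π).subtype
  dec := splitDec X π deg
  act := LinearMap.mk₂ k (fun a m => ⟨X.act a m.1, by
      obtain ⟨m, y, rfl⟩ := m
      exact ⟨_, lin a y⟩⟩)
    (by intros; ext; simp) (by intros; ext; simp) (by intros; ext; simp) (by intros; ext; simp)
  act_one := fun m => Subtype.ext (X.act_one m.1)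
  act_mul := fun x y m => Subtype.ext (X.act_mul x y m.1)
  act_deg := fun i j x m hx hm => X.act_deg i j x m.1 hx hm
  D := X.D.restrict (p := LinearMap.range π) (q := LinearMap.range π) (by
      rintro _ ⟨y, rfl⟩
      exact ⟨_, LinearMap.congr_fun comm y⟩)
  D_deg := fun j m hm => X.D_deg j m.1 hm
  D_sq := fun m => Subtype.ext (X.D_sq m.1)
  leibniz := fun i j x m hx hm => Subtype.ext (by
    have := X.leibniz i j x m.1 hx hm
    simpa using this)

lemma split_summand {C : Module.End k X.M} (hCl : C ∈ Lin X) (hd : HasDeg X.gm X.gm C (-1))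
    (hπ : π = 1 - X.D * C - C * X.D) : IsHoSummand X (splitMod X π deg lin comm) := by
  refine ⟨⟨π.rangeRestrict, ?_, ?_, ?_⟩, ⟨(LinearMap.range π).subtype, ?_, ?_, ?_⟩, -C, ?_, ?_, ?_⟩
  · intro j m hm
    have := deg j m hm
    rw [add_zero] at this
    exact this
  · intro a m; exact Subtype.ext (lin a m)
  · intro m; exact Subtype.ext (LinearMap.congr_fun comm m)
  · intro j m hm; exact hm
  · intro a m; rfl
  · intro m; rfl
  · intro j m hm; exact neg_mem (hd j m hm)
  · intro a m
    rw [LinearMap.neg_apply, LinearMap.neg_apply, hCl a m, map_neg]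
  · intro m
    show π m - m = X.D (-(C m)) + -(C (X.D m))
    rw [hπ, map_neg]
    simp only [LinearMap.sub_apply, Module.End.mul_apply, Module.End.one_apply]
    abel
end Split
end PIF

namespace PIF
section Conc
variable (N : DGMod A) {T : DGBimod A} (B : TB T)

def gen (j : Fin B.s) : N.M →ₗ[k] A.R →ₗ[k] TQ N T := (tm N T).compl₂ (T.actR.flip (B.e j))

lemma gen_apply (j : Fin B.s) (n : N.M) (a : A.R) : gen N B j n a = tm N T n (T.actR a (B.e j)) := rfl

def qq (j : Fin B.s) : TQ N T →ₗ[k] N.M ⊗[k] A.R :=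
  tlift (((LinearMap.rTensorHom A.R) ∘ₗ N.act.flip).compl₂ (B.cd j)) (fun a n v => by
    rw [LinearMap.compl₂_apply, LinearMap.compl₂_apply, B.cd_actL]
    have : LinearMap.rTensor A.R (N.act.flip (N.act a n)) =
        LinearMap.rTensor A.R (N.act.flip n) ∘ₗ mL a := TensorProduct.ext' fun x y => by
      simp [mL, N.act_mul]
    exact LinearMap.congr_fun this _)

lemma qq_tm (j : Fin B.s) (n : N.M) (t : T.M) :
    qq N B j (tm N T n t) = LinearMap.rTensor A.R (N.act.flip n) (B.cd j t) := tlift_tm _ _ _ _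

lemma qq_gen (i j : Fin B.s) (n : N.M) (a : A.R) :
    qq N B i (gen N B j n a) = if i = j then n ⊗ₜ a else 0 := by
  have : T.actR a (B.e j) = thB T (B.e j) (1 ⊗ₜ a) := by rw [thB_tmul, T.actL_one]
  rw [gen_apply, qq_tm, this, B.cd_th]
  split_ifs
  · simp [N.act_one]
  · simp

lemma sum_gen (z : TQ N T) : ∑ j, TensorProduct.lift (gen N B j) (qq N B j z) = z := by
  have : ∑ j, TensorProduct.lift (gen N B j) ∘ₗ qq N B j = LinearMap.id := t_ext fun n t => by
    have h : ∀ j w, TensorProduct.lift (gen N B j) (LinearMap.rTensor A.R (N.act.flip n) w) =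
        tm N T n (thB T (B.e j) w) := by
      intro j w
      have : TensorProduct.lift (gen N B j) ∘ₗ LinearMap.rTensor A.R (N.act.flip n) =
          tm N T n ∘ₗ thB T (B.e j) := TensorProduct.ext' fun x y => by
        simp [gen_apply, tm_act]
      exact LinearMap.congr_fun this w
    simp only [LinearMap.sum_apply, LinearMap.comp_apply, qq_tm, h, LinearMap.id_apply]
    rw [← map_sum, B.sum]
  simpa using LinearMap.congr_fun this z

variable {Q : Type} [AddCommGroup Q] [Module k Q]
variable {N B} in
lemma g_ext {f g : TQ N T →ₗ[k] Q} (h : ∀ j n a, f (gen N B j n a) = g (gen N B j n a)) : f = g := by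
  apply LinearMap.ext
  intro z
  rw [← sum_gen N B z, map_sum, map_sum]
  refine Finset.sum_congr rfl fun j _ => ?_
  have : f ∘ₗ TensorProduct.lift (gen N B j) = g ∘ₗ TensorProduct.lift (gen N B j) :=
    TensorProduct.ext' fun n a => by simpa using h j n a
  exact LinearMap.congr_fun this _

variable {N B} in
def lf (φ : Fin B.s → N.M →ₗ[k] A.R →ₗ[k] Q) : TQ N T →ₗ[k] Q :=
  ∑ j, TensorProduct.lift (φ j) ∘ₗ qq N B j

variable {N B} in
lemma lf_gen (φ : Fin B.s → N.M →ₗ[k] A.R →ₗ[k] Q) (j : Fin B.s) (n : N.M) (a : A.R) :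
    lf φ (gen N B j n a) = φ j n a := by
  rw [lf, LinearMap.sum_apply, Finset.sum_eq_single j]
  · simp [qq_gen]
  · intro i _ hi; simp [qq_gen, hi]
  · simp

/-- filtration -/
def FF (n : ℕ) : Submodule k (TQ N T) := ⨅ i : Fin B.s, ⨅ _ : n ≤ i.val, LinearMap.ker (qq N B i)

variable {N B}
lemma mem_FF {n : ℕ} {z : TQ N T} : z ∈ FF N B n ↔ ∀ i : Fin B.s, n ≤ i.val → qq N B i z = 0 := by
  simp [FF]

lemma FF_mono {n m : ℕ} (h : n ≤ m) : FF N B n ≤ FF N B m := by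
  intro z hz; rw [mem_FF] at hz ⊢
  exact fun i hi => hz i (by omega)
lemma FF_zero : FF N B 0 = ⊥ := by
  rw [eq_bot_iff]; intro z hz
  rw [mem_FF] at hz
  rw [Submodule.mem_bot, ← sum_gen N B z]
  exact Finset.sum_eq_zero fun j _ => by rw [hz j (by omega), map_zero]
lemma FF_top {n : ℕ} (hn : B.s ≤ n) : FF N B n = ⊤ := by
  rw [eq_top_iff]; intro z _
  rw [mem_FF]; intro i hi; have := i.2; omega
lemma tm_FF {n : ℕ} {t : T.M} (ht : t ∈ B.S n) (m : N.M) : tm N T m t ∈ FF N B n := by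
  rw [mem_FF]; intro i hi
  rw [qq_tm, B.mem_S.1 ht i hi, map_zero]
lemma gen_FF {n : ℕ} {j : Fin B.s} (hj : j.val < n) (m : N.M) (a : A.R) : gen N B j m a ∈ FF N B n :=
  tm_FF (B.S_actR (B.e_mem_S j hj) a) m

lemma FF_induct {n : ℕ} {Q : Submodule k (TQ N T)}
    (h : ∀ j : Fin B.s, j.val < n → ∀ m a, gen N B j m a ∈ Q) {z : TQ N T} (hz : z ∈ FF N B n) :
    z ∈ Q := by
  rw [← sum_gen N B z]
  refine Submodule.sum_mem _ fun j _ => ?_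
  by_cases hj : j.val < n
  · have : ∀ w, TensorProduct.lift (gen N B j) w ∈ Q := by
      intro w
      induction w with
      | zero => rw [map_zero]; exact Q.zero_mem
      | tmul x y => rw [TensorProduct.lift.tmul]; exact h j hj x y
      | add a b ha hb => rw [map_add]; exact Q.add_mem ha hb
    exact this _
  · rw [mem_FF.1 hz j (by omega), map_zero]; exact Q.zero_mem

lemma pres_of {G : Module.End k (TQ N T)}
    (h : ∀ (j : Fin B.s) m a n, j.val < n → G (gen N B j m a) ∈ FF N B n) : G ∈ Pres (FF N B) :=
  fun n x hx => FF_induct (Q := (FF N B n).comap G) (fun j hj m a => h j m a n hj) hx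
lemma low_of {G : Module.End k (TQ N T)}
    (h : ∀ (j : Fin B.s) m a, G (gen N B j m a) ∈ FF N B j) : G ∈ Low (FF N B) :=
  fun n x hx => FF_induct (Q := (FF N B n).comap G)
    (fun j hj m a => FF_mono (by omega) (h j m a)) hx

lemma gen_act (b : A.R) (j : Fin B.s) (n : N.M) (a : A.R) :
    tact N T b (gen N B j n a) = gen N B j n (a * b) := by
  rw [gen_apply, tact_tm, gen_apply, T.actR_mul]

lemma lin_of {G : Module.End k (TQ N T)}
    (h : ∀ (j : Fin B.s) m a b, G (gen N B j m (a * b)) = tact N T b (G (gen N B j m a))) :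
    G ∈ Lin (TM N T) := by
  intro b x
  have : G ∘ₗ tact N T b = tact N T b ∘ₗ G := g_ext (B := B) fun j n a => by
    rw [LinearMap.comp_apply, gen_act, h]; rfl
  exact LinearMap.congr_fun this x

lemma gen_mem {i p : ℤ} {j : Fin B.s} {n : N.M} {a : A.R} (hn : n ∈ N.gm i) (ha : a ∈ A.gr p) :
    gen N B j n a ∈ tgm N T (i + (B.r j + p)) :=
  tm_mem hn (T.actR_deg _ _ _ _ ha (B.e_mem j)) rfl

lemma g_span : Submodule.span k {x : TQ N T | ∃ (i p : ℤ) (j : Fin B.s) (n : N.M) (a : A.R),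
    n ∈ N.gm i ∧ a ∈ A.gr p ∧ x = gen N B j n a} = ⊤ := by
  set S := Submodule.span k {x : TQ N T | ∃ (i p : ℤ) (j : Fin B.s) (n : N.M) (a : A.R),
    n ∈ N.gm i ∧ a ∈ A.gr p ∧ x = gen N B j n a} with hS
  have : S.mkQ = 0 := by
    apply g_ext (B := B)
    intro j n v
    have h2 : (gen N B j).compr₂ S.mkQ = 0 := by
      apply gr_ext₂ N.gm A.gr
      intro i n hn p v hv
      exact (Submodule.Quotient.mk_eq_zero _).2 (Submodule.subset_span ⟨i, p, j, n, v, hn, hv, rfl⟩)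
    exact LinearMap.congr_fun₂ h2 n v
  rw [← Submodule.ker_mkQ S, this, LinearMap.ker_zero]

lemma deg_of {G : Module.End k (TQ N T)} {e : ℤ}
    (h : ∀ (i p : ℤ) (j : Fin B.s) (n : N.M) (a : A.R), n ∈ N.gm i → a ∈ A.gr p →
      G (gen N B j n a) ∈ tgm N T (i + (B.r j + p) + e)) : HasDeg (tgm N T) (tgm N T) G e := by
  refine HasDeg.of_span _ _ (g_span (B := B)) ?_
  rintro _ ⟨i, p, j, n, a, hn, ha, rfl⟩
  exact ⟨_, gen_mem hn ha, h i p j n a hn ha⟩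

/-! the operators -/
variable (N B) in
def dl : Module.End k (TQ N T) :=
  lf (N := N) (B := B) fun j => (tm N T).compl₁₂ (eps N.gm) (T.actR.flip (T.D (B.e j)))
lemma dl_gen (j : Fin B.s) (n : N.M) (a : A.R) :
    dl N B (gen N B j n a) = tm N T (eps N.gm n) (T.actR a (T.D (B.e j))) := lf_gen _ _ _ _

lemma D_gen' (j : Fin B.s) (n : N.M) (a : A.R) :
    tD N T (gen N B j n a) = gen N B j (N.D n) a + tm N T (eps N.gm n) (T.actR a (T.D (B.e j))) +
      sgnk k (B.r j) • gen N B j (eps N.gm n) (A.d a) := by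
  rw [gen_apply, tD_tm, bi_leibR, eps_mem T.gm (B.e_mem j), map_add, map_smul, map_smul, ← gen_apply,
    ← gen_apply, add_assoc]

lemma D0_gen (j : Fin B.s) (n : N.M) (a : A.R) :
    (tD N T - dl N B) (gen N B j n a) = gen N B j (N.D n) a +
      sgnk k (B.r j) • gen N B j (eps N.gm n) (A.d a) := by
  rw [LinearMap.sub_apply, D_gen', dl_gen]; abel

lemma dl_low : dl N B ∈ Low (FF N B) := low_of fun j m a => by
  rw [dl_gen]
  exact tm_FF (B.S_actR (B.De_mem j) a) _
lemma dl_lin : dl N B ∈ Lin (TM N T) := lin_of fun j m a b => by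
  rw [dl_gen, dl_gen, tact_tm, T.actR_mul]
lemma dl_deg : HasDeg (tgm N T) (tgm N T) (dl N B) 1 := deg_of fun i p j n a hn ha => by
  rw [dl_gen]
  exact tm_mem (eps_deg N.gm _ _ hn) (T.actR_deg _ _ _ _ ha (T.D_deg _ _ (B.e_mem j))) (by omega)
lemma D_pres : tD N T ∈ Pres (FF N B) := pres_of fun j m a n hj => by
  rw [D_gen']
  exact add_mem (add_mem (gen_FF hj _ _) (FF_mono hj.le (tm_FF (B.S_actR (B.De_mem j) a) _)))
    (Submodule.smul_mem _ _ (gen_FF hj _ _))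

variable (σ : SDR N.gm N.D)
variable (B) in
def c0 : Module.End k (TQ N T) := lf (N := N) (B := B) fun j => (gen N B j) ∘ₗ σ.c
lemma c0_gen (j : Fin B.s) (n : N.M) (a : A.R) :
    c0 B σ (gen N B j n a) = gen N B j (σ.c n) a := lf_gen _ _ _ _
lemma c0_pres : c0 B σ ∈ Pres (FF N B) := pres_of fun j m a n hj => by
  rw [c0_gen]; exact gen_FF hj _ _
lemma c0_lin : c0 B σ ∈ Lin (TM N T) := lin_of fun j m a b => by
  rw [c0_gen, c0_gen, gen_act]
lemma c0_deg : HasDeg (tgm N T) (tgm N T) (c0 B σ) (-1) := deg_of fun i p j n a hn ha => by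
  rw [c0_gen]
  have := gen_mem (B := B) (j := j) (σ.c_deg _ _ hn) ha
  rw [show i + -1 + (B.r j + p) = i + (B.r j + p) + -1 by omega] at this
  exact this
lemma c0_c0 : c0 B σ * c0 B σ = 0 := g_ext (B := B) fun j n a => by
  rw [Module.End.mul_apply, c0_gen, c0_gen, σ.cc]; simp
lemma c0_D0_c0 : c0 B σ * (tD N T - dl N B) * c0 B σ = c0 B σ := g_ext (B := B) fun j n a => by
  rw [Module.End.mul_apply, Module.End.mul_apply, c0_gen, D0_gen, map_add, map_smul, c0_gen, c0_gen,
    σ.cDc, eps_anti' (gm := N.gm) σ.c_deg, map_neg, σ.cc]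
  simp

variable (B) in
def pi0 : Module.End k (TQ N T) := 1 - (tD N T - dl N B) * c0 B σ - c0 B σ * (tD N T - dl N B)
lemma pi0_gen (j : Fin B.s) (n : N.M) (a : A.R) :
    pi0 B σ (gen N B j n a) = ∑ l, σ.lam l n • gen N B j (σ.h l) a := by
  have h := congrArg (fun x => gen N B j x a) (σ.proj n)
  simp only [map_sub, map_sum, map_smul, LinearMap.sub_apply, LinearMap.sum_apply,
    LinearMap.smul_apply] at h
  rw [← h, pi0]
  simp only [LinearMap.sub_apply (f := (1 : Module.End k (TQ N T)) - _), LinearMap.sub_apply (f := (1 : Module.End k (TQ N T))), Module.End.mul_apply, Module.End.one_apply, c0_gen, D0_gen, map_add, map_smul,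
    eps_anti' (gm := N.gm) σ.c_deg, map_neg, LinearMap.neg_apply, smul_neg]
  abel
lemma lam_h' (j : Fin B.s) (l : Fin σ.r) (a : A.R) : pi0 B σ (gen N B j (σ.h l) a) = gen N B j (σ.h l) a := by
  rw [pi0_gen, Finset.sum_eq_single l]
  · rw [σ.lam_h, if_pos rfl, one_smul]
  · intro m _ hm; rw [σ.lam_h, if_neg hm, zero_smul]
  · simp
lemma pi0_idem : pi0 B σ * pi0 B σ = pi0 B σ := g_ext (B := B) fun j n a => by
  rw [Module.End.mul_apply, pi0_gen, map_sum]
  simp only [map_smul, lam_h']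
lemma pi0_pres : pi0 B σ ∈ Pres (FF N B) := pres_of fun j m a n hj => by
  rw [pi0_gen]
  exact sum_mem fun l _ => Submodule.smul_mem _ _ (gen_FF hj _ _)

/-! coordinates -/
variable (B) in
def zz (v : Fin B.s × Fin σ.r → A.R) : TQ N T := ∑ p, gen N B p.1 (σ.h p.2) (v p)
variable (B) in
def vv (z : TQ N T) (p : Fin B.s × Fin σ.r) : A.R :=
  TensorProduct.lid k A.R (LinearMap.rTensor A.R (σ.lam p.2) (qq N B p.1 z))
lemma vv_zz (v : Fin B.s × Fin σ.r → A.R) : vv B σ (zz B σ v) = v := by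
  funext p
  rw [vv, zz]
  simp only [map_sum, qq_gen]
  rw [Finset.sum_eq_single p]
  · simp [σ.lam_h]
  · intro q _ hq
    split_ifs with h
    · rw [LinearMap.rTensor_tmul, σ.lam_h, if_neg (fun h' => hq (Prod.ext h.symm h'.symm))]; simp
    · simp
  · simp
lemma zz_vv (z : TQ N T) : zz B σ (vv B σ z) = pi0 B σ z := by
  have : ∑ p : Fin B.s × Fin σ.r, gen N B p.1 (σ.h p.2) ∘ₗ (TensorProduct.lid k A.R).toLinearMap ∘ₗ
      (LinearMap.rTensor A.R (σ.lam p.2)) ∘ₗ (qq N B p.1) = pi0 B σ := g_ext (B := B) fun j n a => by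
    rw [pi0_gen, LinearMap.sum_apply, Fintype.sum_prod_type, Finset.sum_eq_single j]
    · simp [qq_gen]
    · intro i _ hi
      simp [qq_gen, hi]
    · simp
  rw [← this, zz]
  simp [vv]
lemma pi0_zz (v : Fin B.s × Fin σ.r → A.R) : pi0 B σ (zz B σ v) = zz B σ v := by
  rw [zz, map_sum]
  simp only [lam_h']
lemma vv_FF {n : ℕ} {z : TQ N T} (hz : z ∈ FF N B n) (p : Fin B.s × Fin σ.r) (hp : n ≤ p.1.val) :
    vv B σ z p = 0 := by
  rw [vv, mem_FF.1 hz _ hp]; simp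
end Conc
end PIF

namespace PIF

lemma exists_twisted (N : DGMod A) (hN : GrFin N.gm N.D) {T : DGBimod A} (hT : IsTwistedB T) :
    ∃ T' : DGMod A, IsTwisted T' ∧ IsHoSummand (TM N T) T' := by
  obtain ⟨σ⟩ := exists_sdr N.gm N.D N.D_deg N.D_sq hN
  obtain ⟨B⟩ := exists_TB T hT
  have hF : ∀ n, FF N B n ≤ FF N B (n + 1) := fun n => FF_mono (by omega)
  have F0 : FF N B 0 = ⊥ := FF_zero
  have Fs : FF N B (B.s + 1) = ⊤ := FF_top (by omega)
  have hnil : (dl N B * c0 B σ) ^ (B.s + 1) = 0 :=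
    Low.nil F0 Fs (Low.mul_pres dl_low (c0_pres σ))
  set C : Module.End k (TQ N T) := hC (B.s + 1) (c0 B σ) (dl N B) with hCdef
  have CC : C * C = 0 := hC_sq _ (c0_c0 σ)
  have CDC : C * tD N T * C = C := hC_D _ hnil (c0_D0_c0 σ)
  have Cd : HasDeg (tgm N T) (tgm N T) C (-1) := hC_deg _ (c0_deg σ) dl_deg
  have Cl : C ∈ Lin (TM N T) := hC_lin (TM N T) _ (c0_lin σ) dl_lin
  have DD : tD N T * tD N T = 0 := LinearMap.ext fun x => (TM N T).D_sq x
  set π : Module.End k (TQ N T) := 1 - tD N T * C - C * tD N T with hπdef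
  have hπ : π * π = π := pi_idem DD CC CDC
  have hcomm : π * tD N T = tD N T * π := pi_comm DD
  have hDdeg : HasDeg (tgm N T) (tgm N T) (tD N T) 1 := (TM N T).D_deg
  have hdeg : HasDeg (tgm N T) (tgm N T) π 0 :=
    deg_sub (deg_sub deg_one (deg_mul hDdeg Cd (by omega))) (deg_mul Cd hDdeg (by omega))
  have hlin : π ∈ Lin (TM N T) := pi_lin (TM N T) Cl Cd
  have hν : π - pi0 B σ ∈ Low (FF N B) := hC_nu (by omega) hF (c0_pres σ) dl_low D_pres
  have hpres : π ∈ Pres (FF N B) := by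
    have := add_mem (Low.pres hF hν) (pi0_pres σ)
    rwa [sub_add_cancel] at this
  obtain ⟨ψ, ψ', hψ', h1, h2, h3, h4⟩ := exists_psi hF F0 Fs hπ (pi0_idem σ) (pi0_pres σ) hν
  -- filtered surjectivity
  have surj : ∀ n, ∀ y ∈ FF N B n, π y = y → ∃ v : Fin B.s × Fin σ.r → A.R,
      π (zz B σ v) = y ∧ ∀ p, n ≤ p.1.val → v p = 0 := by
    intro n y hy hyπ
    refine ⟨vv B σ (ψ' y), ?_, fun p hp => vv_FF σ (hψ' n y hy) p hp⟩
    rw [zz_vv, ← Module.End.mul_apply, ← h4, Module.End.mul_apply, ← Module.End.mul_apply ψ, h1]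
    exact hyπ
  have inj : ∀ v w, π (zz B σ v) = π (zz B σ w) → v = w := by
    have key : ∀ v, ψ' (π (zz B σ v)) = zz B σ v := by
      intro v
      have e : π (zz B σ v) = ψ (zz B σ v) := by
        conv_lhs => rw [← pi0_zz σ v, ← Module.End.mul_apply, ← h3, Module.End.mul_apply, pi0_zz]
      rw [e, ← Module.End.mul_apply, h2]; rfl
    intro v w h
    have := congrArg ψ' h
    rw [key, key] at this
    rw [← vv_zz σ v, this, vv_zz]
  let T' : DGMod A := splitMod (TM N T) π hdeg hlin hcomm
  have hX : IsHoSummand (TM N T) T' := split_summand (TM N T) π hdeg hlin hcomm Cl Cd rfl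
  refine ⟨T', ?_, hX⟩
  let f : Fin B.s × Fin σ.r → T'.M := fun p => ⟨π (gen N B p.1 (σ.h p.2) 1), ⟨_, rfl⟩⟩
  let E : Fin B.s × Fin σ.r ≃ Fin (B.s * σ.r) := finProdFinEquiv
  have hact : ∀ p a, (T'.act a (f p)).1 = π (gen N B p.1 (σ.h p.2) a) := by
    intro p a
    show tact N T a (π (gen N B p.1 (σ.h p.2) 1)) = _
    have := hlin a (gen N B p.1 (σ.h p.2) 1)
    refine this.symm.trans ?_
    show π (tact N T a _) = _
    rw [gen_act, one_mul]
  have hsum : ∀ v : Fin B.s × Fin σ.r → A.R, (∑ p, T'.act (v p) (f p)).1 = π (zz B σ v) := by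
    intro v
    have e : (∑ p, T'.act (v p) (f p)).1 = ∑ p, (T'.act (v p) (f p)).1 :=
      map_sum (LinearMap.range π).subtype _ _
    rw [e, zz, map_sum]
    exact Finset.sum_congr rfl fun p _ => hact p (v p)
  refine ⟨B.s * σ.r, fun q => -(σ.deg (E.symm q).2 + (B.r (E.symm q).1 + 0)), fun q => f (E.symm q), ?_, ?_, ?_⟩
  · intro q
    rw [neg_neg]
    have := hdeg _ _ (gen_mem (N := N) (B := B) (j := (E.symm q).1) (σ.h_mem (E.symm q).2) A.one_mem)
    rw [add_zero] at this
    exact this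
  · intro q
    obtain ⟨p, rfl⟩ := E.surjective q
    show T'.D (f (E.symm (E p))) ∈ _
    rw [E.symm_apply_apply]
    have hD : (T'.D (f p)).1 = π (tD N T (gen N B p.1 (σ.h p.2) 1)) :=
      (LinearMap.congr_fun hcomm (gen N B p.1 (σ.h p.2) 1)).symm
    have hw : tD N T (gen N B p.1 (σ.h p.2) 1) ∈ FF N B p.1 := by
      rw [D_gen', σ.Dh, d_one]
      simp only [map_zero, LinearMap.zero_apply, zero_add, smul_zero, add_zero]
      exact tm_FF (B.S_actR (B.De_mem p.1) 1) _
    obtain ⟨v, hv, hv0⟩ := surj p.1 _ (hpres _ _ hw) (LinearMap.congr_fun hπ _)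
    have e : T'.D (f p) = ∑ p, T'.act (v p) (f p) := Subtype.ext (by rw [hsum, hv, hD])
    rw [e]
    refine Submodule.mem_sInf.2 ?_
    rintro S ⟨hS, hSa⟩
    refine sum_mem fun p' _ => ?_
    by_cases h : p.1.val ≤ p'.1.val
    · rw [hv0 p' h, map_zero]; exact zero_mem _
    · apply hSa
      apply hS
      refine ⟨E p', ?_, by simp only [E.symm_apply_apply]⟩
      show (finProdFinEquiv p').val < (finProdFinEquiv p).val
      simp only [finProdFinEquiv_apply_val]
      have a1 := p'.2.2
      have a2 : σ.r * (p'.1.val + 1) ≤ σ.r * p.1.val := Nat.mul_le_mul_left _ (by omega)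
      rw [mul_add] at a2
      omega
  · have hcoe : ∀ v : Fin (B.s * σ.r) → A.R, (∑ q, T'.act (v q) (f (E.symm q))).1 =
        π (zz B σ (fun p => v (E p))) := by
      intro v
      have e : ∑ q, T'.act (v q) (f (E.symm q)) = ∑ p, T'.act (v (E p)) (f p) := by
        rw [← E.sum_comp]
        exact Finset.sum_congr rfl fun p _ => by rw [E.symm_apply_apply]
      exact (congrArg Subtype.val e).trans (hsum fun p => v (E p))
    constructor
    · intro v w h
      have := inj _ _ ((hcoe v).symm.trans ((congrArg Subtype.val h).trans (hcoe w)))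
      funext q
      have h' := congrFun this (E.symm q)
      simpa using h'
    · rintro ⟨y, hy⟩
      obtain ⟨v, hv, -⟩ := surj (B.s + 1) y (by rw [Fs]; trivial) ((mem_rg hπ).1 hy)
      refine ⟨fun q => v (E.symm q), Subtype.ext ?_⟩
      refine (hcoe _).trans ?_
      simp only [E.symm_apply_apply]
      exact hv

lemma fin_perfect (hs : IsSmooth A) (N : DGMod A) (hN : GrFin N.gm N.D) : IsPerfect N := by
  obtain ⟨T, P, hT, hPT, F, hF⟩ := hs
  obtain ⟨T', hT', hXT'⟩ := exists_twisted N hN hT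
  exact ⟨T', TM N P, hT', hoSummand_trans (TM_summand N hPT) hXT', TMev N F, TMev_qis N hT hPT F hF⟩
end PIF


/-- Let `A` be a compact homologically smooth DG algebra.  A DG
`A`-module `N` is perfect if and only if its total cohomology `H(N) = ⊕ₙ Hⁿ(N)` is
finite dimensional over `k`. -/
theorem perfect_iff_finite_cohomology {k : Type} [Field k] (A : DGAlgebra k)
    (hc : IsCompactAlg A) (hs : IsSmooth A) (N : DGMod A) :
    IsPerfect N ↔
      ((∀ n : ℤ, FiniteDimensional k (Hg N.gm N.D n)) ∧
        {n : ℤ | ¬ Subsingleton (Hg N.gm N.D n)}.Finite) := by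
  exact ⟨fun h => PIF.perfect_fin hc N h, fun h => PIF.fin_perfect hs N h⟩
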